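/- Let R be a non-negatively graded Cohen-Macaulay ring with R_0 an Artinian local ring, 𝔪 its maximal homogeneous ideal, and d = dim R. Let C_• : ⋯ → C_2 → C_1 → C_0 → 0 be a graded complex of finitely generated graded R-modules and M = H_0(C_•). Fix integers i and t with 1 ≤ t ≤ i ≤ d and assume that H^{i−t}_𝔪(M) is finitely generated, that (1) i ≤ depth(M/H^0_𝔪(M)), (2) dim H_j(C_•) ≤ i + j − t for all j with 1 ≤ j ≤ d − 1 − i + t, and (3) C_j is a maximal Cohen-Macaulay module for all j with 0 ≤ j ≤ d − i + t. Then max{ b_0(H^{i−t}_𝔪(M)) − Θ_t, a_i(M) } ≤ b_0(C_{d−i}) + a(R). -/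

import Mathlib

/-!
Statement 6 (Corollary `reg_i` of the paper).

`R` is a non-negatively graded Cohen–Macaulay ring with `R₀ = 𝒜 0` an Artinian local
ring, `𝔪` the maximal homogeneous ideal, `d = dim R`; `C_•` a graded complex of
finitely generated graded `R`-modules with `M = H₀(C_•)`; `1 ≤ t ≤ i ≤ d`;
`H^{i-t}_𝔪(M)` finitely generated; (1) `i ≤ depth M/H⁰_𝔪(M)`;
(2) `dim H_j(C_•) ≤ i + j - t` for `1 ≤ j ≤ d - 1 - i + t`;
(3) `C_j` maximal Cohen–Macaulay for `0 ≤ j ≤ d - i + t`.  Then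

`max{ b₀(H^{i-t}_𝔪(M)) − Θ_t, a_i(M) } ≤ b₀(C_{d-i}) + a(R)`.

Graded local cohomology is expressed via the Koszul-cohomology direct-limit
predicates, on a minimal homogeneous generating set `y` of `𝔪` with weakly
decreasing degrees `e` (so `Θ_t = e 0 + ⋯ + e (t-1)`); the inequality is in
universally quantified form over the bounds `β ≥ b₀(C_{d-i})`, `γ ≥ a(R)`:
`H^{i-t}_𝔪(M)` is generated in degrees `≤ β + γ + Θ_t` (via `KGenLE`) and
`[H^i_𝔪(M)]_ℓ = 0` for all `ℓ > β + γ` (via `KVanish`).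
-/

open CategoryTheory

noncomputable section
namespace Paper

variable {R : Type} [CommRing R]

def maxHomIdeal (𝒜 : ℤ → AddSubgroup R) [GradedRing 𝒜] : Ideal R :=
  Ideal.span ({ r : R | ∃ h : r ∈ 𝒜 0, ¬ IsUnit (⟨r, h⟩ : 𝒜 0) } ∪
    ⋃ (i : ℤ) (_ : i ≠ 0), (𝒜 i : Set R))

def GenDegLE {M : Type} [AddCommGroup M] [Module R M] (ℳ : ℤ → AddSubgroup M) (b : ℤ) : Prop :=
  Submodule.span R (⋃ (j : ℤ) (_ : j ≤ b), (ℳ j : Set M)) = ⊤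

def depthGE (I : Ideal R) (N : Type) [AddCommGroup N] [Module R N] (k : ℕ) : Prop :=
  Subsingleton N ∨ ∃ rs : List R, rs.length = k ∧ (∀ r ∈ rs, r ∈ I) ∧
    RingTheory.Sequence.IsRegular N rs

def modDimLE (N : Type) [AddCommGroup N] [Module R N] (b : ℕ) : Prop :=
  ringKrullDim (R ⧸ Module.annihilator R N) ≤ (b : WithBot (WithTop ℕ))

def torsionSubmodule (I : Ideal R) (M : Type) [AddCommGroup M] [Module R M] :
    Submodule R M where
  carrier := { x | ∃ t : ℕ, ∀ r ∈ I ^ t, r • x = 0 }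
  zero_mem' := ⟨0, fun r _ => smul_zero r⟩
  add_mem' := by
    rintro a b ⟨t, ht⟩ ⟨m, hm⟩
    refine ⟨t + m, fun r hr => ?_⟩
    have h1 : r ∈ I ^ t := Ideal.pow_le_pow_right (Nat.le_add_right t m) hr
    have h2 : r ∈ I ^ m := Ideal.pow_le_pow_right (Nat.le_add_left m t) hr
    rw [smul_add, ht r h1, hm r h2, add_zero]
  smul_mem' := by
    rintro c x ⟨t, ht⟩
    exact ⟨t, fun r hr => by rw [smul_comm, ht r hr, smul_zero]⟩

abbrev Hmod (C : ℕ → Type) [∀ j, AddCommGroup (C j)] [∀ j, Module R (C j)]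
    (dl : ∀ j, C (j + 1) →ₗ[R] C j) (j : ℕ) : Type :=
  ↥(LinearMap.ker (dl j)) ⧸
    (Submodule.comap (LinearMap.ker (dl j)).subtype (LinearMap.range (dl (j + 1))))

abbrev KCochain (n : ℕ) (M : Type) (i : ℕ) : Type := {S : Finset (Fin n) // S.card = i} → M

variable {n : ℕ} (y : Fin n → R) {M : Type} [AddCommGroup M] [Module R M]

def kd (t i : ℕ) (f : KCochain n M i) : KCochain n M (i + 1) := fun T =>
  ∑ j ∈ T.1.attach,
    ((-1 : ℤ) ^ ((T.1.filter (fun a => a < j.1)).card)) •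
      ((y j.1 ^ t) • f ⟨T.1.erase j.1, by simp [Finset.card_erase_of_mem j.2, T.2]⟩)

def kTrans (s : ℕ) (i : ℕ) (f : KCochain n M i) : KCochain n M i := fun S =>
  ((∏ j ∈ S.1, y j) ^ s) • f S

def KHomog (ℳ : ℤ → AddSubgroup M) (e : Fin n → ℤ) (t : ℕ) (ℓ : ℤ) {i : ℕ}
    (f : KCochain n M i) : Prop :=
  ∀ S, f S ∈ ℳ (ℓ + (t : ℤ) * ∑ j ∈ S.1, e j)

def IsKBoundary (t : ℕ) : (i : ℕ) → KCochain n M i → Prop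
  | 0, f => f = 0
  | (i + 1), f => ∃ g : KCochain n M i, kd y t i g = f

def KVanish (ℳ : ℤ → AddSubgroup M) (e : Fin n → ℤ) (i : ℕ) (ℓ : ℤ) : Prop :=
  ∀ (t : ℕ) (f : KCochain n M i), kd y t i f = 0 → KHomog ℳ e t ℓ f →
    ∃ s : ℕ, IsKBoundary y (t + s) i (kTrans y s i f)

def KGenLE (ℳ : ℤ → AddSubgroup M) (e : Fin n → ℤ) (i : ℕ) (β : ℤ) : Prop :=
  ∀ (t : ℕ) (ℓ : ℤ) (f : KCochain n M i), kd y t i f = 0 → KHomog ℳ e t ℓ f →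
    ∃ (s : ℕ) (b g : KCochain n M i), IsKBoundary y (t + s) i b ∧
      g ∈ Submodule.span R {h : KCochain n M i | kd y (t + s) i h = 0 ∧
        ∃ ℓ' ≤ β, KHomog ℳ e (t + s) ℓ' h} ∧
      kTrans y s i f = b + g

section Exterior

variable {N : Type} [AddCommGroup N] [Module R N]

/-- The sign of moving the index `j` past the smaller elements of `S`. -/
def ksign (j : Fin n) (S : Finset (Fin n)) : ℤ := (-1) ^ (S.filter (· < j)).card

lemma ksign_mul_self (j : Fin n) (S : Finset (Fin n)) : ksign j S * ksign j S = 1 := by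
  unfold ksign
  rw [← mul_pow]
  simp

lemma ksign_insert_of_lt {i j : Fin n} {S : Finset (Fin n)} (hj : j ∉ S) (h : j < i) :
    ksign i (insert j S) = -ksign i S := by
  unfold ksign
  rw [Finset.filter_insert, if_pos h, Finset.card_insert_of_notMem (by simp [hj]), pow_succ]
  ring

lemma ksign_insert_of_not_lt {i j : Fin n} (S : Finset (Fin n)) (h : ¬ j < i) :
    ksign i (insert j S) = ksign i S := by
  unfold ksign
  rw [Finset.filter_insert, if_neg h]

lemma ksign_insert_self (j : Fin n) (S : Finset (Fin n)) :
    ksign j (insert j S) = ksign j S :=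
  ksign_insert_of_not_lt S (lt_irrefl j)

lemma ksign_erase_of_lt {i j : Fin n} {S : Finset (Fin n)} (hj : j ∈ S) (h : j < i) :
    ksign i (S.erase j) = -ksign i S := by
  conv_rhs => rw [← Finset.insert_erase hj]
  rw [ksign_insert_of_lt (Finset.notMem_erase j S) h, neg_neg]

lemma ksign_erase_of_not_lt {i j : Fin n} {S : Finset (Fin n)} (hj : j ∈ S) (h : ¬ j < i) :
    ksign i (S.erase j) = ksign i S := by
  conv_rhs => rw [← Finset.insert_erase hj]
  rw [ksign_insert_of_not_lt _ h]

/-- Exterior multiplication by the `j`-th basis vector. -/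
def cre (R : Type) [CommRing R] (N : Type) [AddCommGroup N] [Module R N] (j : Fin n) :
    (Finset (Fin n) → N) →ₗ[R] (Finset (Fin n) → N) where
  toFun f S := if j ∈ S then ksign j S • f (S.erase j) else 0
  map_add' f g := by ext S; by_cases h : j ∈ S <;> simp [h]
  map_smul' r f := by
    ext S
    by_cases h : j ∈ S <;> simp [h, smul_comm r]

/-- Contraction with the `j`-th basis vector. -/
def con (R : Type) [CommRing R] (N : Type) [AddCommGroup N] [Module R N] (j : Fin n) :
    (Finset (Fin n) → N) →ₗ[R] (Finset (Fin n) → N) where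
  toFun f S := if j ∈ S then 0 else ksign j S • f (insert j S)
  map_add' f g := by ext S; by_cases h : j ∈ S <;> simp [h]
  map_smul' r f := by
    ext S
    by_cases h : j ∈ S <;> simp [h, smul_comm r]

lemma cre_apply (j : Fin n) (f : Finset (Fin n) → N) (S : Finset (Fin n)) :
    cre R N j f S = if j ∈ S then ksign j S • f (S.erase j) else 0 := rfl

lemma con_apply (j : Fin n) (f : Finset (Fin n) → N) (S : Finset (Fin n)) :
    con R N j f S = if j ∈ S then 0 else ksign j S • f (insert j S) := rfl

lemma cre_cre_self (j : Fin n) (f : Finset (Fin n) → N) : cre R N j (cre R N j f) = 0 := by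
  ext S
  simp [cre_apply]

lemma con_con_self (j : Fin n) (f : Finset (Fin n) → N) : con R N j (con R N j f) = 0 := by
  ext S
  simp [con_apply]

lemma cre_cre (i j : Fin n) (f : Finset (Fin n) → N) :
    cre R N i (cre R N j f) = -cre R N j (cre R N i f) := by
  rcases eq_or_ne i j with rfl | hij
  · simp [cre_cre_self]
  ext S
  by_cases hi : i ∈ S <;> by_cases hj : j ∈ S <;>
    simp only [cre_apply, hi, hj, Finset.mem_erase, ne_eq, hij, hij.symm, not_false_eq_true,
      if_true, if_false, Pi.neg_apply, smul_zero, neg_zero, and_self, and_false]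
  rw [smul_smul, smul_smul, Finset.erase_right_comm, ← neg_smul]
  congr 1
  rcases lt_or_gt_of_ne hij with h | h
  · rw [ksign_erase_of_lt hi h, ksign_erase_of_not_lt hj h.not_gt]; ring
  · rw [ksign_erase_of_not_lt hi h.not_gt, ksign_erase_of_lt hj h]; ring

lemma con_con (i j : Fin n) (f : Finset (Fin n) → N) :
    con R N i (con R N j f) = -con R N j (con R N i f) := by
  rcases eq_or_ne i j with rfl | hij
  · simp [con_con_self]
  ext S
  by_cases hi : i ∈ S <;> by_cases hj : j ∈ S <;>
    simp only [con_apply, hi, hj, Finset.mem_insert, hij, hij.symm, or_true, or_self,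
      if_true, if_false, Pi.neg_apply, smul_zero, neg_zero]
  rw [smul_smul, smul_smul, Finset.insert_comm, ← neg_smul]
  congr 1
  rcases lt_or_gt_of_ne hij with h | h
  · rw [ksign_insert_of_lt hi h, ksign_insert_of_not_lt _ h.not_gt]; ring
  · rw [ksign_insert_of_not_lt _ h.not_gt, ksign_insert_of_lt hj h]; ring

lemma con_cre_self (j : Fin n) (f : Finset (Fin n) → N) :
    con R N j (cre R N j f) + cre R N j (con R N j f) = f := by
  ext S
  by_cases hj : j ∈ S
  · simp only [Pi.add_apply, con_apply, cre_apply, hj, if_true, Finset.notMem_erase, if_false,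
      zero_add, Finset.insert_erase, smul_smul]
    rw [ksign_erase_of_not_lt hj (lt_irrefl j), ksign_mul_self, one_smul]
  · simp [con_apply, cre_apply, hj, smul_smul, ksign_insert_self, ksign_mul_self]

lemma con_cre {i j : Fin n} (hij : i ≠ j) (f : Finset (Fin n) → N) :
    con R N i (cre R N j f) = -cre R N j (con R N i f) := by
  ext S
  by_cases hi : i ∈ S <;> by_cases hj : j ∈ S <;>
    simp only [con_apply, cre_apply, hi, hj, Finset.mem_insert, Finset.mem_erase, ne_eq, hij,
      hij.symm, not_false_eq_true, and_true, false_or, and_false, if_true, if_false, Pi.neg_apply,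
      smul_zero, neg_zero]
  rw [smul_smul, smul_smul, Finset.erase_insert_of_ne hij, ← neg_smul]
  congr 1
  rcases lt_or_gt_of_ne hij with h | h
  · rw [ksign_insert_of_lt hi h, ksign_erase_of_not_lt hj h.not_gt]; ring
  · rw [ksign_insert_of_not_lt _ h.not_gt, ksign_erase_of_lt hj h]; ring

/-- The homological Koszul differential. -/
def kbd (N : Type) [AddCommGroup N] [Module R N] :
    (Finset (Fin n) → N) →ₗ[R] (Finset (Fin n) → N) :=
  ∑ j, y j • con R N j

/-- The cohomological Koszul differential of the sequence `y j ^ t`. -/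
def kcd (N : Type) [AddCommGroup N] [Module R N] (t : ℕ) :
    (Finset (Fin n) → N) →ₗ[R] (Finset (Fin n) → N) :=
  ∑ j, (y j ^ t) • cre R N j

lemma kbd_eq (f : Finset (Fin n) → N) : kbd y N f = ∑ j, y j • con R N j f := by
  simp [kbd]

lemma kcd_eq (t : ℕ) (f : Finset (Fin n) → N) :
    kcd y N t f = ∑ j, (y j ^ t) • cre R N j f := by
  simp [kcd]

lemma sum_sum_eq_zero_of_antisymm {N : Type} [AddCommGroup N] (F : Fin n → Fin n → N)
    (hs : ∀ i, F i i = 0) (ha : ∀ i j, F i j = -F j i) : ∑ i, ∑ j, F i j = 0 := by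
  rw [← Finset.sum_product']
  refine Finset.sum_involution (fun p _ => (p.2, p.1)) ?_ ?_ (by simp) (by simp)
  · rintro ⟨i, j⟩ -
    simp [ha i j]
  · rintro ⟨i, j⟩ - h heq
    simp only [Prod.mk.injEq] at heq
    exact h (by rw [heq.1]; exact hs _)

lemma kbd_kbd (f : Finset (Fin n) → N) : kbd y N (kbd y N f) = 0 := by
  rw [kbd_eq, kbd_eq]
  simp only [map_sum, map_smul, Finset.smul_sum]
  refine sum_sum_eq_zero_of_antisymm _ (fun i => by simp [con_con_self]) fun i j => ?_
  rw [con_con i j, smul_neg, smul_neg, smul_comm]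

lemma kcd_kcd (t : ℕ) (f : Finset (Fin n) → N) : kcd y N t (kcd y N t f) = 0 := by
  rw [kcd_eq, kcd_eq]
  simp only [map_sum, map_smul, Finset.smul_sum]
  refine sum_sum_eq_zero_of_antisymm _ (fun i => by simp [cre_cre_self]) fun i j => ?_
  rw [cre_cre i j, smul_neg, smul_neg, smul_comm]

lemma kbd_cre (j : Fin n) (f : Finset (Fin n) → N) :
    kbd y N (cre R N j f) + cre R N j (kbd y N f) = y j • f := by
  rw [kbd_eq, kbd_eq, map_sum, ← Finset.sum_add_distrib, Finset.sum_eq_single j]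
  · rw [map_smul, ← smul_add, con_cre_self]
  · intro i _ hi
    rw [con_cre hi, map_smul, smul_neg, neg_add_cancel]
  · simp

lemma kcd_con (t : ℕ) (j : Fin n) (f : Finset (Fin n) → N) :
    kcd y N t (con R N j f) + con R N j (kcd y N t f) = (y j ^ t) • f := by
  rw [kcd_eq, kcd_eq, map_sum, ← Finset.sum_add_distrib, Finset.sum_eq_single j]
  · rw [map_smul, ← smul_add, add_comm, con_cre_self]
  · intro i _ hi
    rw [map_smul, con_cre hi.symm, smul_neg, add_neg_cancel]
  · simp

/-- Projection onto the components indexed by sets of cardinality `k`. -/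
def cardProj (R : Type) [CommRing R] (n : ℕ) (N : Type) [AddCommGroup N] [Module R N] (k : ℤ) :
    (Finset (Fin n) → N) →ₗ[R] (Finset (Fin n) → N) where
  toFun f S := if (S.card : ℤ) = k then f S else 0
  map_add' f g := by ext S; by_cases h : (S.card : ℤ) = k <;> simp [h]
  map_smul' r f := by ext S; by_cases h : (S.card : ℤ) = k <;> simp [h]

lemma cardProj_apply (k : ℤ) (f : Finset (Fin n) → N) (S : Finset (Fin n)) :
    cardProj R n N k f S = if (S.card : ℤ) = k then f S else 0 := rfl

lemma cardProj_cre (k : ℤ) (j : Fin n) (f : Finset (Fin n) → N) :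
    cardProj R n N (k + 1) (cre R N j f) = cre R N j (cardProj R n N k f) := by
  ext S
  simp only [cardProj_apply, cre_apply]
  by_cases hj : j ∈ S
  · have : ((S.erase j).card : ℤ) = k ↔ (S.card : ℤ) = k + 1 := by
      have := Finset.card_erase_add_one hj
      omega
    simp only [hj, if_true, this]
    split_ifs <;> simp
  · simp [hj]

lemma cardProj_con (k : ℤ) (j : Fin n) (f : Finset (Fin n) → N) :
    cardProj R n N k (con R N j f) = con R N j (cardProj R n N (k + 1) f) := by
  ext S
  simp only [cardProj_apply, con_apply]
  by_cases hj : j ∈ S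
  · simp [hj]
  · have : ((insert j S).card : ℤ) = k + 1 ↔ (S.card : ℤ) = k := by
      have := Finset.card_insert_of_notMem hj
      omega
    simp only [hj, if_false, this]
    split_ifs <;> simp

lemma cardProj_kbd (k : ℤ) (f : Finset (Fin n) → N) :
    cardProj R n N k (kbd y N f) = kbd y N (cardProj R n N (k + 1) f) := by
  simp only [kbd_eq, map_sum, map_smul, cardProj_con]

lemma cardProj_kcd (k : ℤ) (t : ℕ) (f : Finset (Fin n) → N) :
    cardProj R n N (k + 1) (kcd y N t f) = kcd y N t (cardProj R n N k f) := by
  simp only [kcd_eq, map_sum, map_smul, cardProj_cre]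

lemma cardProj_cardProj (k : ℤ) (f : Finset (Fin n) → N) :
    cardProj R n N k (cardProj R n N k f) = cardProj R n N k f := by
  ext S
  by_cases h : (S.card : ℤ) = k <;> simp [cardProj_apply, h]

end Exterior

section CechComplex

variable {N N' N'' : Type} [AddCommGroup N''] [Module R N''] [AddCommGroup N'] [Module R N']
  [AddCommGroup N] [Module R N]

/-- The transition map between Koszul cochains of different levels. -/
def ktr (N : Type) [AddCommGroup N] [Module R N] (s : ℕ) :
    (Finset (Fin n) → N) →ₗ[R] (Finset (Fin n) → N) where
  toFun f S := (∏ j ∈ S, y j) ^ s • f S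
  map_add' f g := by ext S; simp
  map_smul' r f := by ext S; simp [smul_comm r]

lemma ktr_apply (s : ℕ) (f : Finset (Fin n) → N) (S : Finset (Fin n)) :
    ktr y N s f S = (∏ j ∈ S, y j) ^ s • f S := rfl

lemma ktr_zero (f : Finset (Fin n) → N) : ktr y N 0 f = f := by
  ext S
  simp [ktr_apply]

lemma ktr_ktr (s t : ℕ) (f : Finset (Fin n) → N) : ktr y N s (ktr y N t f) = ktr y N (t + s) f := by
  ext S
  simp [ktr_apply, smul_smul, ← pow_add, add_comm]

instance ktrSystem (N : Type) [AddCommGroup N] [Module R N] :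
    DirectedSystem (fun _ : ℕ => Finset (Fin n) → N) (fun s t _ => ⇑(ktr y N (t - s))) where
  map_self i x := by rw [Nat.sub_self, ktr_zero]
  map_map i j k hij hjk x := by rw [ktr_ktr]; congr 2; omega

/-- The total module of the Čech complex of `N` on the sequence `y`, as the direct limit of the
Koszul cochains of the powers of `y`. -/
def Cech (N : Type) [AddCommGroup N] [Module R N] : Type :=
  DirectLimit (fun _ : ℕ => Finset (Fin n) → N) (fun s t _ => ktr y N (t - s))

namespace Cech

instance : AddCommGroup (Cech y N) :=
  inferInstanceAs (AddCommGroup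
    (DirectLimit (fun _ : ℕ => Finset (Fin n) → N) (fun s t _ => ktr y N (t - s))))

instance : Module R (Cech y N) :=
  inferInstanceAs (Module R
    (DirectLimit (fun _ : ℕ => Finset (Fin n) → N) (fun s t _ => ktr y N (t - s))))

variable {y}

/-- The class of a Koszul cochain of level `t`. -/
def mk (y : Fin n → R) (N : Type) [AddCommGroup N] [Module R N] (t : ℕ) :
    (Finset (Fin n) → N) →ₗ[R] Cech y N :=
  DirectLimit.Module.of R ℕ (fun _ : ℕ => Finset (Fin n) → N) (fun s t _ => ktr y N (t - s)) t

lemma mk_ktr (t s : ℕ) (f : Finset (Fin n) → N) : mk y N (t + s) (ktr y N s f) = mk y N t f := by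
  have := DirectLimit.Module.of_f (R := R) (G := fun _ : ℕ => Finset (Fin n) → N)
    (f := fun s t _ => ktr y N (t - s)) (hij := Nat.le_add_right t s) (x := f)
  rwa [Nat.add_sub_cancel_left] at this

lemma exists_mk (z : Cech y N) : ∃ t f, z = mk y N t f :=
  DirectLimit.exists_eq_mk _ z

lemma exists_mk₂ (z : Cech y N) (w : Cech y N') :
    ∃ t f g, z = mk y N t f ∧ w = mk y N' t g := by
  obtain ⟨t, f, rfl⟩ := exists_mk z
  obtain ⟨s, g, rfl⟩ := exists_mk w
  refine ⟨t + s, ktr y N s f, ktr y N' t g, (mk_ktr _ _ _).symm, ?_⟩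
  rw [add_comm, mk_ktr]

lemma mk_eq_zero (t : ℕ) (f : Finset (Fin n) → N) :
    mk y N t f = 0 ↔ ∃ s, ktr y N s f = 0 := by
  constructor
  · intro h
    obtain ⟨i, hi, h0⟩ := (DirectLimit.exists_eq_zero (f := fun s t _ => ktr y N (t - s))
      (G := fun _ : ℕ => Finset (Fin n) → N) (x := ⟨t, f⟩)).1 h
    exact ⟨i - t, h0⟩
  · rintro ⟨s, hs⟩
    rw [← mk_ktr t s, hs, map_zero]

lemma mk_eq_mk (t : ℕ) (f g : Finset (Fin n) → N) :
    mk y N t f = mk y N t g ↔ ∃ s, ktr y N s f = ktr y N s g := by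
  rw [← sub_eq_zero, ← map_sub, mk_eq_zero]
  simp [sub_eq_zero]

/-- An additive map of Čech complexes given by a compatible family of maps of cochains. -/
def addMap (g : ℕ → (Finset (Fin n) → N) →+ (Finset (Fin n) → N'))
    (hg : ∀ t s f, ktr y N' s (g t f) = g (t + s) (ktr y N s f)) : Cech y N →+ Cech y N' where
  toFun := DirectLimit.map _ _ (fun t f => g t f) fun i j h f => by
    have := hg i (j - i) f
    rw [Nat.add_sub_cancel' h] at this
    exact this
  map_zero' := by
    rw [← map_zero (mk y N 0)]
    refine Eq.trans ?_ (map_zero (mk y N' 0))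
    rw [← map_zero (g 0)]
    rfl
  map_add' z w := by
    obtain ⟨t, f, f', rfl, rfl⟩ := exists_mk₂ z w
    rw [← map_add]
    refine Eq.trans (b := mk y N' t (g t (f + f'))) rfl ?_
    rw [map_add, map_add]
    rfl

lemma addMap_mk (g : ℕ → (Finset (Fin n) → N) →+ (Finset (Fin n) → N'))
    (hg : ∀ t s f, ktr y N' s (g t f) = g (t + s) (ktr y N s f)) (t : ℕ)
    (f : Finset (Fin n) → N) : addMap g hg (mk y N t f) = mk y N' t (g t f) := rfl

/-- A linear map of Čech complexes given by a compatible family of maps of cochains. -/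
def linMap (g : ℕ → (Finset (Fin n) → N) →ₗ[R] (Finset (Fin n) → N'))
    (hg : ∀ t s f, ktr y N' s (g t f) = g (t + s) (ktr y N s f)) : Cech y N →ₗ[R] Cech y N' :=
  { addMap (fun t => (g t).toAddMonoidHom) hg with
    map_smul' := fun r z => by
      obtain ⟨t, f, rfl⟩ := exists_mk z
      rw [← map_smul]
      change mk y N' t (g t (r • f)) = r • mk y N' t (g t f)
      rw [map_smul, map_smul] }

end Cech

open Cech

lemma ktr_kcd (t s : ℕ) (f : Finset (Fin n) → N) :
    ktr y N s (kcd y N t f) = kcd y N (t + s) (ktr y N s f) := by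
  ext S
  simp only [kcd_eq, ktr_apply, Finset.sum_apply, Pi.smul_apply, cre_apply, Finset.smul_sum]
  refine Finset.sum_congr rfl fun j _ => ?_
  by_cases hj : j ∈ S
  · simp only [hj, if_true]
    rw [← Finset.mul_prod_erase S y hj, smul_comm (_ : R) (ksign j S) , smul_comm (_ : R) (ksign j S),
      smul_smul, smul_comm (_ : R) (ksign j S), smul_smul]
    congr 2
    ring
  · simp [hj]

lemma ktr_cardProj (k : ℤ) (s : ℕ) (f : Finset (Fin n) → N) :
    ktr y N s (cardProj R n N k f) = cardProj R n N k (ktr y N s f) := by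
  ext S
  simp only [ktr_apply, cardProj_apply]
  split_ifs <;> simp

/-- The Čech differential. -/
def cd (N : Type) [AddCommGroup N] [Module R N] : Cech y N →ₗ[R] Cech y N :=
  linMap (kcd y N) (ktr_kcd y)

/-- Projection of the Čech complex to cohomological degree `k`. -/
def cdeg (N : Type) [AddCommGroup N] [Module R N] (k : ℤ) : Cech y N →ₗ[R] Cech y N :=
  linMap (fun _ => cardProj R n N k) fun _ s f => ktr_cardProj y k s f

/-- The map of Čech complexes induced by a linear map. -/
def cmap (φ : N →ₗ[R] N') : Cech y N →ₗ[R] Cech y N' :=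
  linMap (fun _ => φ.compLeft (Finset (Fin n))) fun _ s f => by
    ext S
    simp [ktr_apply]

variable {y}

lemma cd_mk (t : ℕ) (f : Finset (Fin n) → N) : cd y N (mk y N t f) = mk y N t (kcd y N t f) := rfl

lemma cdeg_mk (k : ℤ) (t : ℕ) (f : Finset (Fin n) → N) :
    cdeg y N k (mk y N t f) = mk y N t (cardProj R n N k f) := rfl

lemma cmap_mk (φ : N →ₗ[R] N') (t : ℕ) (f : Finset (Fin n) → N) :
    cmap y φ (mk y N t f) = mk y N' t (fun S => φ (f S)) := rfl

lemma cd_cd (z : Cech y N) : cd y N (cd y N z) = 0 := by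
  obtain ⟨t, f, rfl⟩ := exists_mk z
  rw [cd_mk, cd_mk, kcd_kcd, map_zero]

lemma cdeg_cd (k : ℤ) (z : Cech y N) : cdeg y N (k + 1) (cd y N z) = cd y N (cdeg y N k z) := by
  obtain ⟨t, f, rfl⟩ := exists_mk z
  rw [cd_mk, cdeg_mk, cdeg_mk, cd_mk, cardProj_kcd]

lemma cdeg_cdeg (k : ℤ) (z : Cech y N) : cdeg y N k (cdeg y N k z) = cdeg y N k z := by
  obtain ⟨t, f, rfl⟩ := exists_mk z
  rw [cdeg_mk, cdeg_mk, cardProj_cardProj]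

lemma cdeg_of_neg {k : ℤ} (hk : k < 0) (z : Cech y N) : cdeg y N k z = 0 := by
  obtain ⟨t, f, rfl⟩ := exists_mk z
  rw [cdeg_mk]
  convert map_zero (mk y N t)
  ext S
  rw [cardProj_apply, if_neg (by omega), Pi.zero_apply]

lemma cmap_cd (φ : N →ₗ[R] N') (z : Cech y N) : cmap y φ (cd y N z) = cd y N' (cmap y φ z) := by
  obtain ⟨t, f, rfl⟩ := exists_mk z
  rw [cd_mk, cmap_mk, cmap_mk, cd_mk]
  congr 1
  ext S
  simp only [kcd_eq, Finset.sum_apply, Pi.smul_apply, map_sum, map_smul, cre_apply]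
  refine Finset.sum_congr rfl fun j _ => ?_
  split_ifs <;> simp

lemma cmap_cdeg (φ : N →ₗ[R] N') (k : ℤ) (z : Cech y N) :
    cmap y φ (cdeg y N k z) = cdeg y N' k (cmap y φ z) := by
  obtain ⟨t, f, rfl⟩ := exists_mk z
  rw [cdeg_mk, cmap_mk, cmap_mk, cdeg_mk]
  congr 1
  ext S
  simp only [cardProj_apply]
  split_ifs <;> simp

lemma cmap_comp (ψ : N' →ₗ[R] N'') (φ : N →ₗ[R] N') (z : Cech y N) :
    cmap y (ψ ∘ₗ φ) z = cmap y ψ (cmap y φ z) := by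
  obtain ⟨t, f, rfl⟩ := exists_mk z
  rfl

lemma cmap_zero (z : Cech y N) : cmap y (0 : N →ₗ[R] N') z = 0 := by
  obtain ⟨t, f, rfl⟩ := exists_mk z
  exact map_zero (mk y N' t)

lemma cmap_add (φ ψ : N →ₗ[R] N') (z : Cech y N) :
    cmap y (φ + ψ) z = cmap y φ z + cmap y ψ z := by
  obtain ⟨t, f, rfl⟩ := exists_mk z
  rw [cmap_mk, cmap_mk, cmap_mk, ← map_add]
  rfl

lemma cmap_smul_id (r : R) (z : Cech y N) :
    cmap y (r • (LinearMap.id : N →ₗ[R] N)) z = r • z := by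
  obtain ⟨t, f, rfl⟩ := exists_mk z
  rw [cmap_mk, ← map_smul]
  rfl

lemma cmap_injective {φ : N →ₗ[R] N'} (hφ : Function.Injective φ) :
    Function.Injective (cmap y φ) := by
  rw [injective_iff_map_eq_zero]
  intro z hz
  obtain ⟨t, f, rfl⟩ := exists_mk z
  rw [cmap_mk, mk_eq_zero] at hz
  obtain ⟨s, hs⟩ := hz
  rw [mk_eq_zero]
  refine ⟨s, funext fun S => hφ ?_⟩
  have := congrFun hs S
  simpa [ktr_apply] using this

lemma cmap_surjective {φ : N →ₗ[R] N'} (hφ : Function.Surjective φ) :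
    Function.Surjective (cmap y φ) := by
  intro z
  obtain ⟨t, f, rfl⟩ := exists_mk z
  choose g hg using fun S => hφ (f S)
  exact ⟨mk y N t g, by rw [cmap_mk]; congr 1; ext S; exact hg S⟩

lemma cmap_exact {φ : N →ₗ[R] N'} {ψ : N' →ₗ[R] N''} (h : Function.Exact φ ψ) :
    Function.Exact (cmap y φ) (cmap y ψ) := by
  intro z
  constructor
  · intro hz
    obtain ⟨t, f, rfl⟩ := exists_mk z
    rw [cmap_mk, mk_eq_zero] at hz
    obtain ⟨s, hs⟩ := hz
    have key : ∀ S, ∃ x, φ x = ktr y N' s f S := fun S =>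
      (h _).1 (by simpa [ktr_apply] using congrFun hs S)
    choose g hg using key
    refine ⟨mk y N (t + s) g, ?_⟩
    rw [cmap_mk, ← mk_ktr t s]
    congr 1
    ext S
    exact hg S
  · rintro ⟨w, rfl⟩
    rw [← cmap_comp, h.linearMap_comp_eq_zero, cmap_zero]

lemma exists_pow_smul_eq_cd (j : Fin n) {z : Cech y N} (hz : cd y N z = 0) :
    ∃ t : ℕ, ∃ w, (y j ^ t) • z = cd y N w := by
  obtain ⟨t, f, rfl⟩ := exists_mk z
  rw [cd_mk, mk_eq_zero] at hz
  obtain ⟨s, hs⟩ := hz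
  rw [ktr_kcd] at hs
  refine ⟨t + s, mk y N (t + s) (con R N j (ktr y N s f)), ?_⟩
  rw [cd_mk, ← mk_ktr t s f, ← map_smul, ← kcd_con, hs, map_zero, add_zero]

/-- Čech cohomology is torsion with respect to the ideal generated by the sequence. -/
lemma exists_pow_smul_mem_range {r : R} (hr : r ∈ Ideal.span (Set.range y)) {z : Cech y N}
    (hz : cd y N z = 0) : ∃ t : ℕ, (r ^ t) • z ∈ LinearMap.range (cd y N) := by
  let I : Ideal R := (LinearMap.range (cd y N)).comap (LinearMap.toSpanSingleton R _ z)
  have : Ideal.span (Set.range y) ≤ I.radical := by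
    rw [Ideal.span_le]
    rintro _ ⟨j, rfl⟩
    obtain ⟨t, w, hw⟩ := exists_pow_smul_eq_cd j hz
    exact ⟨t, by simp only [I, Submodule.mem_comap, LinearMap.toSpanSingleton_apply]; exact ⟨w, hw.symm⟩⟩
  obtain ⟨t, ht⟩ := this hr
  exact ⟨t, ht⟩

end CechComplex

section Acyclic

variable {X Y W : Type} [AddCommGroup X] [Module R X] [AddCommGroup Y] [Module R Y]
  [AddCommGroup W] [Module R W]

open Cech
open scoped Pointwise

/-- Vanishing of the `k`-th Čech cohomology. -/
def Acyc (y : Fin n → R) (N : Type) [AddCommGroup N] [Module R N] (k : ℤ) : Prop :=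
  ∀ z : Cech y N, cdeg y N k z = z → cd y N z = 0 → z ∈ LinearMap.range (cd y N)

lemma cdeg_cd' (k : ℤ) (z : Cech y M) : cdeg y M k (cd y M z) = cd y M (cdeg y M (k - 1) z) := by
  rw [← cdeg_cd, sub_add_cancel]

variable {y}

lemma exists_homog_cd {k : ℤ} {z : Cech y M} (hz : cdeg y M k z = z)
    (h : z ∈ LinearMap.range (cd y M)) : ∃ w, cdeg y M (k - 1) w = w ∧ cd y M w = z := by
  obtain ⟨w, rfl⟩ := h
  exact ⟨cdeg y M (k - 1) w, cdeg_cdeg _ _, by rw [← cdeg_cd', hz]⟩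

lemma exists_homog_lift {ψ : Y →ₗ[R] W} (hψ : Function.Surjective ψ) {k : ℤ} {w : Cech y W}
    (hw : cdeg y W k w = w) : ∃ v, cdeg y Y k v = v ∧ cmap y ψ v = w := by
  obtain ⟨v, rfl⟩ := cmap_surjective hψ w
  exact ⟨cdeg y Y k v, cdeg_cdeg _ _, by rw [cmap_cdeg, hw]⟩

lemma exists_homog_preimage {φ : X →ₗ[R] Y} {ψ : Y →ₗ[R] W} (h : Function.Exact φ ψ) {k : ℤ}
    {v : Cech y Y} (hv : cdeg y Y k v = v) (h0 : cmap y ψ v = 0) :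
    ∃ u, cdeg y X k u = u ∧ cmap y φ u = v := by
  obtain ⟨u, rfl⟩ := (cmap_exact h v).1 h0
  exact ⟨cdeg y X k u, cdeg_cdeg _ _, by rw [cmap_cdeg, hv]⟩

/-- A cocycle lifts along a surjection to a cochain whose differential comes from the kernel. -/
lemma exists_connecting {φ : X →ₗ[R] Y} {ψ : Y →ₗ[R] W} (hφ : Function.Injective φ)
    (hψ : Function.Surjective ψ) (h : Function.Exact φ ψ) {k : ℤ} {w : Cech y W}
    (hw : cdeg y W k w = w) (hw0 : cd y W w = 0) :
    ∃ v u, cdeg y Y k v = v ∧ cmap y ψ v = w ∧ cdeg y X (k + 1) u = u ∧ cd y X u = 0 ∧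
      cmap y φ u = cd y Y v := by
  obtain ⟨v, hv, rfl⟩ := exists_homog_lift hψ hw
  obtain ⟨u, hu, hu'⟩ := exists_homog_preimage h (k := k + 1) (v := cd y Y v)
    (by rw [cdeg_cd, hv]) (by rw [cmap_cd, hw0])
  refine ⟨v, u, hv, rfl, hu, cmap_injective hφ ?_, hu'⟩
  rw [cmap_cd, hu', cd_cd, map_zero]

lemma Acyc.of_subsingleton [Subsingleton M] (k : ℤ) : Acyc y M k := by
  intro z _ _
  obtain ⟨t, f, rfl⟩ := exists_mk z
  rw [Subsingleton.elim f 0, map_zero]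
  exact zero_mem _

lemma mem_range_of_cmap_mem_range_of_acyc {φ : X →ₗ[R] Y} {ψ : Y →ₗ[R] W}
    (hφ : Function.Injective φ) (hψ : Function.Surjective ψ) (h : Function.Exact φ ψ) {k : ℤ}
    (hX : Acyc y X k) {v : Cech y Y} (hv : cdeg y Y k v = v) (hv0 : cd y Y v = 0)
    (hW : cmap y ψ v ∈ LinearMap.range (cd y W)) : v ∈ LinearMap.range (cd y Y) := by
  obtain ⟨w, hw, hw'⟩ := exists_homog_cd (k := k) (z := cmap y ψ v)
    (by rw [← cmap_cdeg, hv]) hW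
  obtain ⟨v', hv', rfl⟩ := exists_homog_lift hψ hw
  obtain ⟨u, hu, hu'⟩ := exists_homog_preimage h (k := k) (v := v - cd y Y v')
    (by rw [map_sub, hv, cdeg_cd', hv']) (by rw [map_sub, cmap_cd, hw', sub_self])
  obtain ⟨u', rfl⟩ := hX u hu (cmap_injective hφ (by
    rw [cmap_cd, hu', map_sub, cd_cd, hv0, sub_zero, map_zero]))
  exact ⟨cmap y φ u' + v', by rw [map_add, ← cmap_cd, hu', sub_add_cancel]⟩

lemma Acyc.middle {φ : X →ₗ[R] Y} {ψ : Y →ₗ[R] W} (hφ : Function.Injective φ)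
    (hψ : Function.Surjective ψ) (h : Function.Exact φ ψ) {k : ℤ} (hX : Acyc y X k)
    (hW : Acyc y W k) : Acyc y Y k := fun v hv hv0 =>
  mem_range_of_cmap_mem_range_of_acyc hφ hψ h hX hv hv0
    (hW _ (by rw [← cmap_cdeg, hv]) (by rw [← cmap_cd, hv0, map_zero]))

lemma mem_range_of_cmap_mem_range {φ : X →ₗ[R] Y} {ψ : Y →ₗ[R] W} (hφ : Function.Injective φ)
    (hψ : Function.Surjective ψ) (h : Function.Exact φ ψ) {k : ℤ} (hW : Acyc y W (k - 1))
    {u : Cech y X} (hu : cdeg y X k u = u)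
    (hv : cmap y φ u ∈ LinearMap.range (cd y Y)) : u ∈ LinearMap.range (cd y X) := by
  obtain ⟨v, hv, hv'⟩ := exists_homog_cd (k := k) (by rw [← cmap_cdeg, hu]) hv
  obtain ⟨w, hw, hw'⟩ := exists_homog_cd (k := k - 1) (z := cmap y ψ v)
    (by rw [← cmap_cdeg, hv])
    (hW _ (by rw [← cmap_cdeg, hv])
      (by rw [← cmap_cd, hv', ← cmap_comp, h.linearMap_comp_eq_zero, cmap_zero]))
  obtain ⟨v', -, rfl⟩ := exists_homog_lift hψ hw
  obtain ⟨u', hu'⟩ := (cmap_exact h (v - cd y Y v')).1 (by rw [map_sub, cmap_cd, hw', sub_self])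
  refine ⟨u', cmap_injective hφ ?_⟩
  rw [cmap_cd, hu', map_sub, cd_cd, sub_zero, hv']

lemma Acyc.left {φ : X →ₗ[R] Y} {ψ : Y →ₗ[R] W} (hφ : Function.Injective φ)
    (hψ : Function.Surjective ψ) (h : Function.Exact φ ψ) {k : ℤ} (hY : Acyc y Y k)
    (hW : Acyc y W (k - 1)) : Acyc y X k := fun u hu hu0 =>
  mem_range_of_cmap_mem_range hφ hψ h hW hu
    (hY _ (by rw [← cmap_cdeg, hu]) (by rw [← cmap_cd, hu0, map_zero]))

lemma Acyc.right {φ : X →ₗ[R] Y} {ψ : Y →ₗ[R] W} (hφ : Function.Injective φ)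
    (hψ : Function.Surjective ψ) (h : Function.Exact φ ψ) {k : ℤ} (hX : Acyc y X (k + 1))
    (hY : Acyc y Y k) : Acyc y W k := by
  intro w hw hw0
  obtain ⟨v, u, hv, rfl, hu, hu0, huv⟩ := exists_connecting hφ hψ h hw hw0
  obtain ⟨u', hu', rfl⟩ := exists_homog_cd hu (hX u hu hu0)
  rw [add_sub_cancel_right] at hu'
  obtain ⟨v', hv'⟩ := hY (v - cmap y φ u') (by rw [map_sub, hv, ← cmap_cdeg, hu'])
    (by rw [map_sub, ← cmap_cd, huv, sub_self])
  refine ⟨cmap y ψ v', ?_⟩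
  rw [← cmap_cd, hv', map_sub, ← cmap_comp, h.linearMap_comp_eq_zero, cmap_zero, sub_zero]

lemma Acyc.of_equiv (f : X ≃ₗ[R] Y) {k : ℤ} (hX : Acyc y X k) : Acyc y Y k :=
  Acyc.right (X := PUnit) (φ := (0 : PUnit →ₗ[R] X)) (ψ := f.toLinearMap)
    (Function.injective_of_subsingleton _) f.surjective
    (fun x => by simpa using eq_comm) (Acyc.of_subsingleton _) hX

lemma exact_smul_mkQ (x : R) (N : Type) [AddCommGroup N] [Module R N] :
    Function.Exact (x • (LinearMap.id : N →ₗ[R] N)) (x • (⊤ : Submodule R N)).mkQ := by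
  intro v
  rw [Submodule.mkQ_apply, Submodule.Quotient.mk_eq_zero]
  simp [Submodule.mem_smul_pointwise_iff_exists]

lemma mem_range_of_pow_smul_mem_range {N : Type} [AddCommGroup N] [Module R N] {x : R}
    (hreg : IsSMulRegular N x) {k : ℤ} (hQ : Acyc y (QuotSMulTop x N) (k - 1)) {z : Cech y N}
    (hz : cdeg y N k z = z) (s : ℕ) (hs : x ^ s • z ∈ LinearMap.range (cd y N)) :
    z ∈ LinearMap.range (cd y N) := by
  induction s with
  | zero => simpa using hs
  | succ s ih =>
    refine ih (mem_range_of_cmap_mem_range (φ := x • LinearMap.id)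
      (ψ := (x • (⊤ : Submodule R N)).mkQ) (fun a b hab => hreg (by simpa using hab))
      (Submodule.mkQ_surjective _) (exact_smul_mkQ x N) hQ
      (by rw [map_smul, hz]) ?_)
    rwa [cmap_smul_id, smul_smul, ← pow_succ']

lemma Acyc.of_regular {N : Type} [AddCommGroup N] [Module R N] {x : R}
    (hx : x ∈ Ideal.span (Set.range y)) (hreg : IsSMulRegular N x) {k : ℤ}
    (hQ : Acyc y (QuotSMulTop x N) (k - 1)) : Acyc y N k := by
  intro z hz hz0
  obtain ⟨s, hs⟩ := exists_pow_smul_mem_range hx hz0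
  exact mem_range_of_pow_smul_mem_range hreg hQ hz s hs

/-- Vanishing of local cohomology below the depth. -/
lemma Acyc.of_isWeaklyRegular (rs : List R) (hrs : ∀ r ∈ rs, r ∈ Ideal.span (Set.range y))
    (N : Type) [AddCommGroup N] [Module R N] (h : RingTheory.Sequence.IsWeaklyRegular N rs)
    (k : ℤ) (hk : k < rs.length) : Acyc y N k := by
  induction rs generalizing N k with
  | nil =>
    intro z hz _
    rw [← hz, cdeg_of_neg (by simpa using hk)]
    exact zero_mem _
  | cons x rs ih =>
    rw [RingTheory.Sequence.isWeaklyRegular_cons_iff] at h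
    exact Acyc.of_regular (hrs x (by simp)) h.1
      (ih (fun r hr => hrs r (by simp [hr])) _ h.2 _ (by simp at hk; omega))

lemma cdeg_eq_zero_of_torsion {N : Type} [AddCommGroup N] [Module R N]
    (h : ∀ (v : N) (j : Fin n), ∃ t : ℕ, y j ^ t • v = 0) {k : ℤ} (hk : 0 < k)
    (z : Cech y N) : cdeg y N k z = 0 := by
  obtain ⟨t, f, rfl⟩ := exists_mk z
  choose T hT using h
  have hle : ∀ S j, T (f S) j ≤ ∑ S, ∑ j, T (f S) j := fun S j =>
    (Finset.single_le_sum (f := fun j => T (f S) j) (fun _ _ => Nat.zero_le _)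
      (Finset.mem_univ j)).trans
    (Finset.single_le_sum (f := fun S => ∑ j, T (f S) j) (fun _ _ => Nat.zero_le _)
      (Finset.mem_univ S))
  rw [cdeg_mk, mk_eq_zero]
  refine ⟨∑ S, ∑ j, T (f S) j, ?_⟩
  ext S
  rw [ktr_apply, cardProj_apply, Pi.zero_apply]
  split_ifs with hS
  · obtain ⟨j, hj⟩ : S.Nonempty := by
      rw [← Finset.card_pos]
      omega
    obtain ⟨c, hc⟩ := Nat.exists_eq_add_of_le (hle S j)
    rw [← Finset.prod_erase_mul S y hj, mul_pow, mul_smul]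
    conv_lhs => rw [hc, pow_add (y j), mul_comm (y j ^ T (f S) j), mul_smul, hT, smul_zero, smul_zero]
  · rw [smul_zero]

lemma Acyc.of_torsion {N : Type} [AddCommGroup N] [Module R N]
    (h : ∀ (v : N) (j : Fin n), ∃ t : ℕ, y j ^ t • v = 0) {k : ℤ} (hk : 0 < k) :
    Acyc y N k := by
  intro z hz _
  rw [← hz, cdeg_eq_zero_of_torsion h hk]
  exact zero_mem _

lemma withBot_lt_of_add_one_le {a b : WithBot ℕ∞} {m : ℕ} (h : a + 1 ≤ b)
    (hb : b < ((m + 1 : ℕ) : WithBot ℕ∞)) : a < (m : WithBot ℕ∞) := by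
  have h' := h.trans_lt hb
  push_cast at h'
  by_contra hc
  exact absurd h' (not_lt.2 (add_le_add_left (not_lt.1 hc) 1))

/-- Grothendieck vanishing: local cohomology vanishes above the dimension. -/
lemma Acyc.of_supportDim_lt [IsNoetherianRing R] (b : ℕ) (N : Type) [AddCommGroup N]
    [Module R N] [Module.Finite R N] (hN : Module.supportDim R N < (b : WithBot ℕ∞)) (k : ℤ)
    (hk : b ≤ k) : Acyc y N k := by
  induction b generalizing N k with
  | zero =>
    have : Subsingleton N := by
      rw [← Module.supportDim_eq_bot_iff_subsingleton R]
      by_contra hne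
      have hnt := (Module.supportDim_ne_bot_iff_nontrivial R N).1 hne
      obtain ⟨a, ha⟩ := WithBot.ne_bot_iff_exists.1 hne
      rw [← ha] at hN
      exact absurd (WithBot.coe_lt_coe.1 hN) (by simp)
    exact Acyc.of_subsingleton k
  | succ b ih =>
    revert hN
    refine IsNoetherianRing.induction_on_isQuotientEquivQuotientPrime R
      (motive := fun N _ _ _ =>
        Module.supportDim R N < ((b + 1 : ℕ) : WithBot ℕ∞) → Acyc y N k) inferInstance
      (fun N _ _ _ _ _ => Acyc.of_subsingleton k) ?_ ?_
    · intro N _ _ _ P f hN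
      rw [Module.supportDim_eq_of_equiv f] at hN
      refine Acyc.of_equiv f.symm ?_
      by_cases hP : Ideal.span (Set.range y) ≤ P.1
      · refine Acyc.of_torsion (fun v j => ⟨1, ?_⟩) (by push_cast at hk; omega)
        obtain ⟨v, rfl⟩ := Ideal.Quotient.mk_surjective v
        rw [pow_one]
        change Ideal.Quotient.mk P.1 (y j * v) = 0
        rw [Ideal.Quotient.eq_zero_iff_mem]
        exact P.1.mul_mem_right _ (hP (Ideal.subset_span ⟨j, rfl⟩))
      · obtain ⟨x, hx, hxP⟩ := Set.not_subset.1 hP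
        have hreg : IsSMulRegular (R ⧸ P.1) x := by
          refine isSMulRegular_iff_right_eq_zero_of_smul.2 fun v hv => ?_
          obtain ⟨v, rfl⟩ := Ideal.Quotient.mk_surjective v
          have hv' : Ideal.Quotient.mk P.1 (x * v) = 0 := hv
          rw [Ideal.Quotient.eq_zero_iff_mem] at hv' ⊢
          exact (P.2.mem_or_mem hv').resolve_left hxP
        refine Acyc.of_regular hx hreg (ih (QuotSMulTop x (R ⧸ P.1)) ?_ _ (by
          push_cast at hk; omega))
        exact withBot_lt_of_add_one_le
          (Module.supportDim_quotSMulTop_succ_le_of_notMem_minimalPrimes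
            fun _ => hreg.notMem_of_mem_minimalPrimes) hN
    · intro N₁ _ _ _ N₂ _ _ _ N₃ _ _ _ f g hf hg hfg h₁ h₃ h
      exact Acyc.middle hf hg hfg
        (h₁ ((Module.supportDim_le_of_injective f hf).trans_lt h))
        (h₃ ((Module.supportDim_le_of_surjective g hg).trans_lt h))

end Acyclic

section Graded

open Cech

/-- A family of additive operators on a module, indexed by degrees, which behaves like the
projections to the graded components with respect to multiplication by the `y j`. -/
structure GrProj (y : Fin n → R) (e : Fin n → ℤ) (N : Type) [AddCommGroup N] [Module R N] where
  /-- The operator attached to a degree. -/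
  p : ℤ → N →+ N
  p_smul : ∀ j ℓ x, p (ℓ + e j) (y j • x) = y j • p ℓ x

variable {y} {e : Fin n → ℤ}
variable {N N' X Y W : Type} [AddCommGroup N] [Module R N] [AddCommGroup N'] [Module R N']
  [AddCommGroup X] [Module R X] [AddCommGroup Y] [Module R Y] [AddCommGroup W] [Module R W]

namespace GrProj

lemma p_pow_smul (G : GrProj y e N) (j : Fin n) (t : ℕ) (ℓ : ℤ) (x : N) :
    G.p (ℓ + t * e j) (y j ^ t • x) = y j ^ t • G.p ℓ x := by
  induction t with
  | zero => simp
  | succ t ih =>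
    rw [pow_succ', mul_smul, mul_smul, ← ih, ← G.p_smul]
    congr 2
    push_cast
    ring

lemma p_prod_pow_smul (G : GrProj y e N) (S : Finset (Fin n)) (t : ℕ) (ℓ : ℤ) (x : N) :
    G.p (ℓ + t * ∑ j ∈ S, e j) ((∏ j ∈ S, y j) ^ t • x) = (∏ j ∈ S, y j) ^ t • G.p ℓ x := by
  induction S using Finset.induction_on with
  | empty => simp
  | insert j S hj ih =>
    rw [Finset.prod_insert hj, Finset.sum_insert hj, mul_pow, mul_smul, mul_smul, ← ih,
      ← p_pow_smul]
    congr 2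
    ring

/-- The operators induced on the Čech complex. -/
def cech (G : GrProj y e N) : GrProj y e (Cech y N) where
  p ℓ := addMap (fun t =>
    { toFun := fun f S => G.p (ℓ + t * ∑ j ∈ S, e j) (f S)
      map_zero' := by ext S; simp
      map_add' := fun f g => by ext S; simp })
    fun t s f => by
      ext S
      simp only [AddMonoidHom.coe_mk, ZeroHom.coe_mk, ktr_apply]
      rw [← p_prod_pow_smul]
      congr 2
      push_cast
      ring
  p_smul j ℓ z := by
    obtain ⟨t, f, rfl⟩ := exists_mk z
    rw [← map_smul, addMap_mk, addMap_mk, ← map_smul]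
    congr 1
    ext S
    simp only [AddMonoidHom.coe_mk, ZeroHom.coe_mk, Pi.smul_apply, ← p_smul]
    congr 2
    ring

lemma cech_mk (G : GrProj y e N) (ℓ : ℤ) (t : ℕ) (f : Finset (Fin n) → N) :
    G.cech.p ℓ (Cech.mk y N t f) = Cech.mk y N t fun S => G.p (ℓ + t * ∑ j ∈ S, e j) (f S) := rfl

lemma cech_cd (G : GrProj y e N) (ℓ : ℤ) (z : Cech y N) :
    G.cech.p ℓ (cd y N z) = cd y N (G.cech.p ℓ z) := by
  obtain ⟨t, f, rfl⟩ := exists_mk z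
  rw [cd_mk, cech_mk, cech_mk, cd_mk]
  congr 1
  ext S
  simp only [kcd_eq, Finset.sum_apply, Pi.smul_apply, map_sum, cre_apply]
  refine Finset.sum_congr rfl fun j _ => ?_
  by_cases hj : j ∈ S
  · simp only [hj, if_true]
    rw [smul_comm, smul_comm _ (ksign j S), map_zsmul, ← G.p_pow_smul, ← Finset.sum_erase_add S _ hj]
    congr 3
    ring
  · simp [hj]

lemma cech_cdeg (G : GrProj y e N) (k ℓ : ℤ) (z : Cech y N) :
    G.cech.p ℓ (cdeg y N k z) = cdeg y N k (G.cech.p ℓ z) := by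
  obtain ⟨t, f, rfl⟩ := exists_mk z
  rw [cdeg_mk, cech_mk, cech_mk, cdeg_mk]
  congr 1
  ext S
  simp only [cardProj_apply]
  split_ifs <;> simp

lemma cech_cmap {G : GrProj y e N} {G' : GrProj y e N'} {φ : N →ₗ[R] N'} {c : ℤ}
    (h : ∀ ℓ x, φ (G.p ℓ x) = G'.p (ℓ + c) (φ x)) (ℓ : ℤ) (z : Cech y N) :
    cmap y φ (G.cech.p ℓ z) = G'.cech.p (ℓ + c) (cmap y φ z) := by
  obtain ⟨t, f, rfl⟩ := exists_mk z
  rw [cech_mk, cmap_mk, cmap_mk, cech_mk]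
  congr 1
  ext S
  rw [h]
  congr 2
  ring

lemma cech_cmap₀ {G : GrProj y e N} {G' : GrProj y e N'} {φ : N →ₗ[R] N'}
    (h : ∀ ℓ x, φ (G.p ℓ x) = G'.p ℓ (φ x)) (ℓ : ℤ) (z : Cech y N) :
    cmap y φ (G.cech.p ℓ z) = G'.cech.p ℓ (cmap y φ z) := by
  have := cech_cmap (c := 0) (φ := φ) (G := G) (G' := G') (fun ℓ x => by rw [h, add_zero]) ℓ z
  rwa [add_zero] at this

/-- The operators induced on a stable submodule. -/
def sub (G : GrProj y e N) (U : Submodule R N) (hU : ∀ ℓ, ∀ x ∈ U, G.p ℓ x ∈ U) :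
    GrProj y e U where
  p ℓ := ((G.p ℓ).comp U.subtype.toAddMonoidHom).codRestrict U fun x => hU ℓ _ x.2
  p_smul j ℓ x := Subtype.ext (G.p_smul j ℓ x)

/-- The operators induced on the quotient by a stable submodule. -/
def quot (G : GrProj y e N) (U : Submodule R N) (hU : ∀ ℓ, ∀ x ∈ U, G.p ℓ x ∈ U) :
    GrProj y e (N ⧸ U) where
  p ℓ := QuotientAddGroup.lift U.toAddSubgroup (U.mkQ.toAddMonoidHom.comp (G.p ℓ)) fun x hx =>
    (Submodule.Quotient.mk_eq_zero U).2 (hU ℓ x hx)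
  p_smul j ℓ x := by
    obtain ⟨x, rfl⟩ := U.mkQ_surjective x
    exact congrArg U.mkQ (G.p_smul j ℓ x)

/-- The projections to the components of a graded module. -/
def ofDecomposition {𝒜 : ℤ → AddSubgroup R} (hy : ∀ j, y j ∈ 𝒜 (e j))
    (ℳ : ℤ → AddSubgroup N) [DirectSum.Decomposition ℳ] [SetLike.GradedSMul 𝒜 ℳ] :
    GrProj y e N where
  p ℓ :=
    { toFun := fun x => (DirectSum.decompose ℳ x ℓ : N)
      map_zero' := by simp
      map_add' := fun x x' => by simp }
  p_smul j ℓ x := by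
    simp only [AddMonoidHom.coe_mk, ZeroHom.coe_mk]
    induction x using DirectSum.Decomposition.inductionOn ℳ with
    | zero => simp
    | @homogeneous k x =>
      have hx : y j • (x : N) ∈ ℳ (e j + k) := SetLike.GradedSMul.smul_mem (hy j) x.2
      rcases eq_or_ne k ℓ with rfl | hk
      · rw [DirectSum.decompose_of_mem_same ℳ x.2, add_comm, DirectSum.decompose_of_mem_same ℳ hx]
      · rw [DirectSum.decompose_of_mem_ne ℳ x.2 hk, smul_zero,
          DirectSum.decompose_of_mem_ne ℳ hx (by omega)]
    | add x x' hx hx' =>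
      simp only [smul_add, DirectSum.decompose_add, DirectSum.add_apply, AddSubgroup.coe_add, hx, hx']

lemma ofDecomposition_of_mem {𝒜 : ℤ → AddSubgroup R} (hy : ∀ j, y j ∈ 𝒜 (e j))
    (ℳ : ℤ → AddSubgroup N) [DirectSum.Decomposition ℳ] [SetLike.GradedSMul 𝒜 ℳ] {ℓ : ℤ}
    {x : N} (hx : x ∈ ℳ ℓ) : (ofDecomposition hy ℳ).p ℓ x = x :=
  DirectSum.decompose_of_mem_same ℳ hx

lemma ofDecomposition_mem {𝒜 : ℤ → AddSubgroup R} (hy : ∀ j, y j ∈ 𝒜 (e j))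
    (ℳ : ℤ → AddSubgroup N) [DirectSum.Decomposition ℳ] [SetLike.GradedSMul 𝒜 ℳ] (ℓ : ℤ)
    (x : N) : (ofDecomposition hy ℳ).p ℓ x ∈ ℳ ℓ :=
  (DirectSum.decompose ℳ x ℓ).2

lemma map_ofDecomposition {𝒜 : ℤ → AddSubgroup R} (hy : ∀ j, y j ∈ 𝒜 (e j))
    (ℳ : ℤ → AddSubgroup N) [DirectSum.Decomposition ℳ] [SetLike.GradedSMul 𝒜 ℳ]
    (ℳ' : ℤ → AddSubgroup N') [DirectSum.Decomposition ℳ'] [SetLike.GradedSMul 𝒜 ℳ']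
    (φ : N →ₗ[R] N') (c : ℤ) (hφ : ∀ ℓ, ∀ x ∈ ℳ ℓ, φ x ∈ ℳ' (ℓ + c)) (ℓ : ℤ) (x : N) :
    φ ((ofDecomposition hy ℳ).p ℓ x) = (ofDecomposition hy ℳ').p (ℓ + c) (φ x) := by
  induction x using DirectSum.Decomposition.inductionOn ℳ with
  | zero => simp
  | @homogeneous k x =>
    rcases eq_or_ne k ℓ with rfl | hk
    · rw [ofDecomposition_of_mem hy ℳ x.2, ofDecomposition_of_mem hy ℳ' (hφ k _ x.2)]
    · refine Eq.trans ?_ (DirectSum.decompose_of_mem_ne ℳ' (hφ k _ x.2) (by omega)).symm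
      exact (congrArg φ (DirectSum.decompose_of_mem_ne ℳ x.2 hk)).trans (map_zero φ)
  | add x x' hx hx' => simp only [map_add, hx, hx']

/-- The operator of degree `ℓ` kills the `k`-th Čech cohomology. -/
def Van (G : GrProj y e N) (k ℓ : ℤ) : Prop :=
  ∀ z : Cech y N, cdeg y N k z = z → cd y N z = 0 → G.cech.p ℓ z ∈ LinearMap.range (cd y N)

/-- The operator of degree `ℓ` maps the `k`-th Čech cohomology into its submodule generated by
the multiples of the `y j`. -/
def Gen (G : GrProj y e N) (k ℓ : ℤ) : Prop :=
  ∀ z : Cech y N, cdeg y N k z = z → cd y N z = 0 →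
    ∃ ζ : Fin n → Cech y N, (∀ j, cdeg y N k (ζ j) = ζ j ∧ cd y N (ζ j) = 0) ∧
      G.cech.p ℓ z - ∑ j, y j • ζ j ∈ LinearMap.range (cd y N)

end GrProj

lemma exists_cocycle_lift {φ : X →ₗ[R] Y} {ψ : Y →ₗ[R] W} (hφ : Function.Injective φ)
    (hψ : Function.Surjective ψ) (h : Function.Exact φ ψ) {k : ℤ} (hX : Acyc y X (k + 1))
    {w : Cech y W} (hw : cdeg y W k w = w) (hw0 : cd y W w = 0) :
    ∃ v, cdeg y Y k v = v ∧ cd y Y v = 0 ∧ cmap y ψ v = w := by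
  obtain ⟨v, u, hv, rfl, hu, hu0, huv⟩ := exists_connecting hφ hψ h hw hw0
  obtain ⟨u', hu', rfl⟩ := exists_homog_cd hu (hX u hu hu0)
  rw [add_sub_cancel_right] at hu'
  refine ⟨v - cmap y φ u', by rw [map_sub, hv, ← cmap_cdeg, hu'],
    by rw [map_sub, ← cmap_cd, huv, sub_self], ?_⟩
  rw [map_sub, ← cmap_comp, h.linearMap_comp_eq_zero, cmap_zero, sub_zero]

namespace GrProj

variable {GX : GrProj y e X} {GY : GrProj y e Y} {GW : GrProj y e W}

lemma Van.of_middle {φ : X →ₗ[R] Y} {ψ : Y →ₗ[R] W} (hφ : Function.Injective φ)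
    (hψ : Function.Surjective ψ) (h : Function.Exact φ ψ)
    (hG : ∀ ℓ x, ψ (GY.p ℓ x) = GW.p ℓ (ψ x)) {k ℓ : ℤ} (hX : Acyc y X (k + 1))
    (hY : GY.Van k ℓ) : GW.Van k ℓ := by
  intro w hw hw0
  obtain ⟨v, hv, hv0, rfl⟩ := exists_cocycle_lift hφ hψ h hX hw hw0
  obtain ⟨q, hq⟩ := hY v hv hv0
  exact ⟨cmap y ψ q, by rw [← cmap_cd, hq, cech_cmap₀ hG]⟩

lemma Van.of_left {φ : X →ₗ[R] Y} {ψ : Y →ₗ[R] W} (hφ : Function.Injective φ)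
    (hψ : Function.Surjective ψ) (h : Function.Exact φ ψ)
    (hGφ : ∀ ℓ x, φ (GX.p ℓ x) = GY.p ℓ (φ x)) (hG : ∀ ℓ x, ψ (GY.p ℓ x) = GW.p ℓ (ψ x))
    {k ℓ : ℤ} (hY : Acyc y Y k) (hX : GX.Van (k + 1) ℓ) : GW.Van k ℓ := by
  intro w hw hw0
  obtain ⟨v, u, hv, rfl, hu, hu0, huv⟩ := exists_connecting hφ hψ h hw hw0
  obtain ⟨q, hq, hq'⟩ := exists_homog_cd (by rw [← cech_cdeg, hu]) (hX u hu hu0)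
  rw [add_sub_cancel_right] at hq
  obtain ⟨r, hr⟩ := hY (GY.cech.p ℓ v - cmap y φ q)
    (by rw [map_sub, ← cech_cdeg, hv, ← cmap_cdeg, hq])
    (by rw [map_sub, ← cmap_cd, hq', cech_cmap₀ hGφ, huv, cech_cd, sub_self])
  refine ⟨cmap y ψ r, ?_⟩
  rw [← cmap_cd, hr, map_sub, cech_cmap₀ hG, ← cmap_comp, h.linearMap_comp_eq_zero, cmap_zero,
    sub_zero]

lemma Gen.of_middle {φ : X →ₗ[R] Y} {ψ : Y →ₗ[R] W} (hφ : Function.Injective φ)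
    (hψ : Function.Surjective ψ) (h : Function.Exact φ ψ)
    (hG : ∀ ℓ x, ψ (GY.p ℓ x) = GW.p ℓ (ψ x)) {k ℓ : ℤ} (hX : Acyc y X (k + 1))
    (hY : GY.Gen k ℓ) : GW.Gen k ℓ := by
  intro w hw hw0
  obtain ⟨v, hv, hv0, rfl⟩ := exists_cocycle_lift hφ hψ h hX hw hw0
  obtain ⟨ζ, hζ, q, hq⟩ := hY v hv hv0
  refine ⟨fun j => cmap y ψ (ζ j), fun j => ⟨by rw [← cmap_cdeg, (hζ j).1],
    by rw [← cmap_cd, (hζ j).2, map_zero]⟩, cmap y ψ q, ?_⟩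
  rw [← cmap_cd, hq, map_sub, cech_cmap₀ hG, map_sum]
  simp only [map_smul]

lemma Gen.of_connecting {φ : X →ₗ[R] Y} {ψ : Y →ₗ[R] W} (hφ : Function.Injective φ)
    (hψ : Function.Surjective ψ) (h : Function.Exact φ ψ)
    (hGφ : ∀ ℓ x, φ (GX.p ℓ x) = GY.p ℓ (φ x)) (hG : ∀ ℓ x, ψ (GY.p ℓ x) = GW.p ℓ (ψ x))
    {k ℓ : ℤ} (hY : Acyc y Y k)
    (hX : ∀ u, cdeg y X (k + 1) u = u → cd y X u = 0 →
      cmap y φ u ∈ LinearMap.range (cd y Y) →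
      ∃ ζ : Fin n → Cech y X, (∀ j, cdeg y X (k + 1) (ζ j) = ζ j ∧
          cmap y φ (ζ j) ∈ LinearMap.range (cd y Y)) ∧
        GX.cech.p ℓ u - ∑ j, y j • ζ j ∈ LinearMap.range (cd y X)) :
    GW.Gen k ℓ := by
  intro w hw hw0
  obtain ⟨v, u, hv, rfl, hu, hu0, huv⟩ := exists_connecting hφ hψ h hw hw0
  obtain ⟨ζ, hζ, hq⟩ := hX u hu hu0 ⟨v, huv.symm⟩
  obtain ⟨q, hq, hq'⟩ := exists_homog_cd (k := k + 1) (by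
    simp only [map_sub, map_sum, map_smul, ← cech_cdeg, hu, (hζ _).1]) hq
  rw [add_sub_cancel_right] at hq
  have key : ∀ j, ∃ v, cdeg y Y k v = v ∧ cd y Y v = cmap y φ (ζ j) := fun j => by
    have := exists_homog_cd (k := k + 1) (z := cmap y φ (ζ j)) (by rw [← cmap_cdeg, (hζ j).1])
      (hζ j).2
    rwa [add_sub_cancel_right] at this
  choose ξ hξ hξ' using key
  obtain ⟨r, hr⟩ := hY (GY.cech.p ℓ v - ∑ j, y j • ξ j - cmap y φ q)
    (by simp only [map_sub, map_sum, map_smul, ← cech_cdeg, hv, ← cmap_cdeg, hq, hξ])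
    (by
      simp only [map_sub, map_sum, map_smul, ← cech_cd, ← cmap_cd, hq', hξ', cech_cmap₀ hGφ, huv]
      abel)
  refine ⟨fun j => cmap y ψ (ξ j), fun j => ⟨by rw [← cmap_cdeg, hξ], ?_⟩, cmap y ψ r, ?_⟩
  · rw [← cmap_cd, hξ', ← cmap_comp, h.linearMap_comp_eq_zero, cmap_zero]
  · rw [← cmap_cd, hr, map_sub, map_sub, cech_cmap₀ hG, ← cmap_comp, h.linearMap_comp_eq_zero,
      cmap_zero, sub_zero, map_sum]
    simp only [map_smul]

lemma Gen.of_left {φ : X →ₗ[R] Y} {ψ : Y →ₗ[R] W} (hφ : Function.Injective φ)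
    (hψ : Function.Surjective ψ) (h : Function.Exact φ ψ)
    (hGφ : ∀ ℓ x, φ (GX.p ℓ x) = GY.p ℓ (φ x)) (hG : ∀ ℓ x, ψ (GY.p ℓ x) = GW.p ℓ (ψ x))
    {k ℓ : ℤ} (hY : Acyc y Y k) (hY' : Acyc y Y (k + 1)) (hX : GX.Gen (k + 1) ℓ) :
    GW.Gen k ℓ :=
  Gen.of_connecting hφ hψ h hGφ hG hY fun u hu hu0 _ => by
    obtain ⟨ζ, hζ, hq⟩ := hX u hu hu0
    exact ⟨ζ, fun j => ⟨(hζ j).1, hY' _ (by rw [← cmap_cdeg, (hζ j).1])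
      (by rw [← cmap_cd, (hζ j).2, map_zero])⟩, hq⟩

lemma cmap_sum {ι : Type} (s : Finset ι) (φ : ι → N →ₗ[R] N') (z : Cech y N) :
    cmap y (∑ i ∈ s, φ i) z = ∑ i ∈ s, cmap y (φ i) z := by
  classical
  induction s using Finset.induction_on with
  | empty => simp [cmap_zero]
  | insert a s ha ih => rw [Finset.sum_insert ha, Finset.sum_insert ha, cmap_add, ih]

/-- Vanishing in degree `ℓ` for a module generated by elements on which the vanishing is known. -/
lemma Van.of_generators {GR : GrProj y e R} {GN : GrProj y e N} {r : ℕ} (c : Fin r → N)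
    (b : Fin r → ℤ) (hc : Submodule.span R (Set.range c) = ⊤)
    (hG : ∀ i ℓ a, GN.p (ℓ + b i) (a • c i) = GR.p ℓ a • c i) {k ℓ : ℤ}
    (hR : ∀ i, GR.Van k (ℓ - b i))
    (hK : Acyc y (LinearMap.ker (Fintype.linearCombination R c)) (k + 1)) : GN.Van k ℓ := by
  intro w hw hw0
  have hsurj : Function.Surjective (Fintype.linearCombination R c) := by
    rw [← LinearMap.range_eq_top, Fintype.range_linearCombination, hc]
  obtain ⟨v, hv, hv0, rfl⟩ := exists_cocycle_lift
    (LinearMap.ker (Fintype.linearCombination R c)).injective_subtype hsurj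
    (LinearMap.exact_subtype_ker_map _) hK hw hw0
  have hsum : Fintype.linearCombination R c =
      ∑ i, (LinearMap.toSpanSingleton R N (c i)) ∘ₗ LinearMap.proj i := by
    ext i
    simp [Pi.single_apply, Fintype.linearCombination_apply]
  rw [hsum, cmap_sum, map_sum]
  refine Submodule.sum_mem _ fun i _ => ?_
  rw [cmap_comp]
  obtain ⟨q, hq⟩ := hR i (cmap y (LinearMap.proj i) v) (by rw [← cmap_cdeg, hv])
    (by rw [← cmap_cd, hv0, map_zero])
  refine ⟨cmap y (LinearMap.toSpanSingleton R N (c i)) q, ?_⟩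
  rw [← cmap_cd, hq, cech_cmap (G := GR) (G' := GN) (c := b i) (fun ℓ a => (hG i ℓ a).symm),
    sub_add_cancel]

end GrProj

end Graded

section KoszulHomology

open Cech
open scoped Pointwise

variable {N N' : Type} [AddCommGroup N] [Module R N] [AddCommGroup N'] [Module R N']

lemma kbd_mem {P : Submodule R N} {w : Finset (Fin n) → N} (h : ∀ S, w S ∈ P)
    (S : Finset (Fin n)) : kbd y N w S ∈ P := by
  rw [kbd_eq, Finset.sum_apply]
  refine Submodule.sum_mem _ fun j _ => P.smul_mem _ ?_
  rw [con_apply]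
  split_ifs
  · exact P.zero_mem
  · exact zsmul_mem (h _) _

lemma cre_mem {P : Submodule R N} {w : Finset (Fin n) → N} (h : ∀ S, w S ∈ P) (j : Fin n)
    (S : Finset (Fin n)) : cre R N j w S ∈ P := by
  rw [cre_apply]
  split_ifs
  · exact zsmul_mem (h _) _
  · exact P.zero_mem

lemma kbd_map (φ : N →ₗ[R] N') (w : Finset (Fin n) → N) :
    kbd y N' (fun S => φ (w S)) = fun S => φ (kbd y N w S) := by
  ext S
  simp only [kbd_eq, Finset.sum_apply, Pi.smul_apply, map_sum, map_smul, con_apply]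
  refine Finset.sum_congr rfl fun j _ => ?_
  split_ifs <;> simp

lemma cardProj_map (φ : N →ₗ[R] N') {s : ℤ} {w : Finset (Fin n) → N}
    (hw : cardProj R n N s w = w) : cardProj R n N' s (fun S => φ (w S)) = fun S => φ (w S) := by
  ext S
  rw [cardProj_apply]
  split_ifs with h
  · rfl
  · rw [← hw, cardProj_apply, if_neg h, map_zero]

lemma cardProj_self_iff {s : ℤ} {w : Finset (Fin n) → N} :
    cardProj R n N s w = w ↔ ∀ S : Finset (Fin n), (S.card : ℤ) ≠ s → w S = 0 := by
  constructor
  · intro h S hS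
    rw [← h, cardProj_apply, if_neg hS]
  · intro h
    ext S
    rw [cardProj_apply]
    split_ifs with hS
    · rfl
    · exact (h S hS).symm

/-- The submodule of cocycles of degree `k` of the Čech complex. -/
def coc (N : Type) [AddCommGroup N] [Module R N] (k : ℤ) : Submodule R (Cech y N) :=
  LinearMap.ker (cd y N) ⊓ LinearMap.ker (cdeg y N k - LinearMap.id)

variable {y}

lemma mem_coc {k : ℤ} {z : Cech y N} :
    z ∈ coc y N k ↔ cd y N z = 0 ∧ cdeg y N k z = z := by
  simp [coc, sub_eq_zero]

lemma cmap_mem_coc (φ : N →ₗ[R] N') {k : ℤ} {z : Cech y N} (hz : z ∈ coc y N k) :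
    cmap y φ z ∈ coc y N' k := by
  rw [mem_coc] at hz ⊢
  rw [← cmap_cd, hz.1, map_zero, ← cmap_cdeg, hz.2]
  exact ⟨rfl, rfl⟩

lemma Acyc.exists_of_mem_coc {k : ℤ} (h : Acyc y N k) {z : Cech y N} (hz : z ∈ coc y N k) :
    ∃ w, cdeg y N (k - 1) w = w ∧ cd y N w = z := by
  rw [mem_coc] at hz
  exact exists_homog_cd hz.2 (h z hz.2 hz.1)

lemma exists_family {P : Finset (Fin n) → N → Prop} (s : ℤ)
    (h : ∀ S : Finset (Fin n), ∃ v, P S v ∧ ((S.card : ℤ) ≠ s → v = 0)) :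
    ∃ v : Finset (Fin n) → N, cardProj R n N s v = v ∧ ∀ S, P S (v S) := by
  choose v hv hv' using h
  exact ⟨v, cardProj_self_iff.2 hv', hv⟩

/-- If multiplication by `x` is injective on `N`, then a cocycle of `N` that becomes a coboundary
modulo `x` is, up to a coboundary, divisible by `x`. -/
lemma exists_eq_smul_add_cd {x : R} (hreg : IsSMulRegular N x) {k : ℤ} {z : Cech y N}
    (hz : z ∈ coc y N k)
    (h : ∃ w, cdeg y _ (k - 1) w = w ∧
      cd y _ w = cmap y (x • (⊤ : Submodule R N)).mkQ z) :
    ∃ u ∈ coc y N k, z - x • u ∈ LinearMap.range (cd y N) := by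
  rw [mem_coc] at hz
  obtain ⟨w, hw, hw'⟩ := h
  obtain ⟨w, hw₁, rfl⟩ := exists_homog_lift (Submodule.mkQ_surjective _) hw
  obtain ⟨u, hu, hu'⟩ := exists_homog_preimage (exact_smul_mkQ x N) (k := k)
    (v := z - cd y N w) (by rw [map_sub, hz.2, cdeg_cd', hw₁])
    (by rw [map_sub, cmap_cd, hw', sub_self])
  refine ⟨u, mem_coc.2 ⟨cmap_injective (φ := x • LinearMap.id)
    (fun a b hab => hreg (by simpa using hab)) ?_, hu⟩, w, ?_⟩
  · rw [cmap_cd, hu', map_sub, cd_cd, hz.1, sub_zero, map_zero]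
  · rw [cmap_smul_id] at hu'
    rw [hu', sub_sub_cancel]

lemma smul_cech_injective {x : R} (hreg : IsSMulRegular N x) {z w : Cech y N}
    (h : x • z = x • w) : z = w :=
  cmap_injective (y := y) (φ := x • (LinearMap.id : N →ₗ[R] N))
    (fun a b hab => hreg (by simpa using hab)) (by rwa [cmap_smul_id, cmap_smul_id])

/-- Multiplication by an element of the ideal generated by `y` on a Koszul cycle up to coboundaries
is a Koszul boundary up to coboundaries. -/
lemma exists_smul_sub_kbd_mem {P Q : Submodule R N} {x : R}
    (hx : x ∈ Ideal.span (Set.range y)) {s : ℤ} {f : Finset (Fin n) → N}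
    (hf : cardProj R n N s f = f) (hfP : ∀ S, f S ∈ P) (hfQ : ∀ S, kbd y N f S ∈ Q) :
    ∃ v, cardProj R n N (s + 1) v = v ∧ (∀ S, v S ∈ P) ∧ ∀ S, x • f S - kbd y N v S ∈ Q := by
  obtain ⟨r, rfl⟩ := Ideal.mem_span_range_iff_exists_fun.1 hx
  refine ⟨∑ j, r j • cre R N j f, ?_, fun S => ?_, fun S => ?_⟩
  · simp only [map_sum, map_smul, cardProj_cre, hf]
  · rw [Finset.sum_apply]
    exact Submodule.sum_mem _ fun j _ => P.smul_mem _ (cre_mem hfP j S)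
  · have : (∑ j, r j * y j) • f - kbd y N (∑ j, r j • cre R N j f) =
        ∑ j, r j • cre R N j (kbd y N f) := by
      simp only [map_sum, map_smul, Finset.sum_smul, ← Finset.sum_sub_distrib, mul_smul,
        ← smul_sub]
      refine Finset.sum_congr rfl fun j _ => ?_
      rw [← kbd_cre y j f, add_sub_cancel_left]
    have hS := congrFun this S
    rw [Pi.sub_apply, Pi.smul_apply] at hS
    rw [hS, Finset.sum_apply]
    exact Submodule.sum_mem _ fun j _ => Q.smul_mem _ (cre_mem hfQ j S)

/-- The Koszul homology of the top local cohomology of a Cohen-Macaulay module vanishes below the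
dimension. -/
lemma exists_kbd_of_isWeaklyRegular [IsNoetherianRing R] (rs : List R)
    (hrs : ∀ r ∈ rs, r ∈ Ideal.span (Set.range y)) (N : Type) [AddCommGroup N] [Module R N]
    [Module.Finite R N] (h : RingTheory.Sequence.IsWeaklyRegular N rs)
    (hdim : Module.supportDim R N < ((rs.length + 1 : ℕ) : WithBot ℕ∞)) (s : ℤ)
    (hs : s < rs.length) (w : Finset (Fin n) → Cech y N) (hw : cardProj R n _ s w = w)
    (hwc : ∀ S, w S ∈ coc y N rs.length)
    (hwb : ∀ S, kbd y _ w S ∈ LinearMap.range (cd y N)) :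
    ∃ v, cardProj R n _ (s + 1) v = v ∧ (∀ S, v S ∈ coc y N rs.length) ∧
      ∀ S, w S - kbd y _ v S ∈ LinearMap.range (cd y N) := by
  induction rs generalizing N s with
  | nil =>
    refine ⟨0, map_zero _, fun S => zero_mem _, fun S => ?_⟩
    rw [← hw, cardProj_apply, if_neg (by simp at hs; omega), map_zero, Pi.zero_apply, sub_zero]
    exact zero_mem _
  | cons x rs ih =>
    rw [RingTheory.Sequence.isWeaklyRegular_cons_iff] at h
    obtain ⟨hreg, hQ⟩ := h
    have hx := hrs x (by simp)
    have hrs' : ∀ r ∈ rs, r ∈ Ideal.span (Set.range y) := fun r hr => hrs r (by simp [hr])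
    have hQdim : Module.supportDim R (QuotSMulTop x N) < ((rs.length + 1 : ℕ) : WithBot ℕ∞) :=
      withBot_lt_of_add_one_le (Module.supportDim_quotSMulTop_succ_le_of_notMem_minimalPrimes
        fun _ => hreg.notMem_of_mem_minimalPrimes) hdim
    have hlen : (((x :: rs).length : ℕ) : ℤ) = rs.length + 1 := by simp
    rw [hlen] at hs hwc ⊢
    have hNac : Acyc y N rs.length := by
      refine Acyc.of_isWeaklyRegular (x :: rs) hrs N
        ((RingTheory.Sequence.isWeaklyRegular_cons_iff _ _ _).2 ⟨hreg, hQ⟩) _ ?_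
      rw [hlen]
      omega
    have hQac : Acyc y (QuotSMulTop x N) (rs.length + 1) :=
      Acyc.of_supportDim_lt (rs.length + 1) _ hQdim _ (by simp)
    let ψ : N →ₗ[R] QuotSMulTop x N := (x • (⊤ : Submodule R N)).mkQ
    have hψ : Function.Surjective ψ := Submodule.mkQ_surjective _
    have hw0 := (cardProj_self_iff (R := R)).1 hw
    obtain ⟨w', hw', hw'P⟩ := exists_family (R := R) (P := fun S u => u ∈ coc y N (rs.length + 1) ∧
        w S - x • u ∈ LinearMap.range (cd y N)) s fun S => by
      by_cases hS : (S.card : ℤ) = s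
      · obtain ⟨u, hu⟩ := exists_eq_smul_add_cd hreg (hwc S)
          (hQac.exists_of_mem_coc (cmap_mem_coc _ (hwc S)))
        exact ⟨u, hu, fun h => absurd hS h⟩
      · refine ⟨0, ⟨zero_mem _, ?_⟩, fun _ => rfl⟩
        rw [hw0 S hS, smul_zero, sub_zero]
        exact zero_mem _
    have hxw' : ∀ S, x • kbd y _ w' S ∈ LinearMap.range (cd y N) := fun S => by
      have h1 := kbd_mem (R := R) y (w := w - x • w') (fun S => (hw'P S).2) S
      rw [map_sub, map_smul, Pi.sub_apply, Pi.smul_apply] at h1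
      exact (Submodule.sub_mem_iff_right _ (hwb S)).1 h1
    obtain ⟨b, hb, hbP⟩ := exists_family (R := R) (P := fun S u => cdeg y N rs.length u = u ∧
        cd y N u = x • kbd y _ w' S) (s - 1) fun S => by
      by_cases hS : (S.card : ℤ) = s - 1
      · obtain ⟨u, hu, hu'⟩ := exists_homog_cd (k := rs.length + 1) (by
          rw [map_smul, (mem_coc.1 (kbd_mem y (fun S => (hw'P S).1) S)).2]) (hxw' S)
        rw [add_sub_cancel_right] at hu
        exact ⟨u, ⟨hu, hu'⟩, fun h => absurd hS h⟩
      · refine ⟨0, ⟨map_zero _, ?_⟩, fun _ => rfl⟩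
        have : cardProj R n _ (s - 1) (kbd y _ w') = kbd y _ w' := by
          rw [cardProj_kbd, sub_add_cancel, hw']
        rw [map_zero, (cardProj_self_iff (R := R)).1 this S hS, smul_zero]
    have hkb : ∀ S, kbd y _ b S ∈ coc y N rs.length := fun S => by
      rw [mem_coc]
      constructor
      · have h1 := congrFun (kbd_map y (cd y N) b) S
        rw [← h1]
        have h2 : (fun S => cd y N (b S)) = x • kbd y _ w' := funext fun S => (hbP S).2
        rw [h2, map_smul, kbd_kbd, smul_zero, Pi.zero_apply]
      · have h1 := congrFun (kbd_map y (cdeg y N rs.length) b) S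
        rw [← h1]
        simp only [(hbP _).1]
    obtain ⟨v, hv, hvc, hvb⟩ := ih hrs' (QuotSMulTop x N) hQ hQdim (s - 1) (by omega)
      (fun S => cmap y ψ (b S)) (cardProj_map _ hb)
      (fun S => by
        rw [mem_coc, ← cmap_cdeg, (hbP S).1, ← cmap_cd, (hbP S).2, ← cmap_smul_id,
          ← cmap_comp, (exact_smul_mkQ x N).linearMap_comp_eq_zero, cmap_zero]
        exact ⟨rfl, rfl⟩)
      (fun S => by
        rw [kbd_map]
        obtain ⟨q, -, hq⟩ := hNac.exists_of_mem_coc (hkb S)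
        exact ⟨cmap y ψ q, by rw [← cmap_cd, hq]⟩)
    rw [sub_add_cancel] at hv
    obtain ⟨v', hv', hv'P⟩ := exists_family (R := R) (P := fun S u => cdeg y N rs.length u = u ∧
        cmap y ψ u = v S) s fun S => by
      by_cases hS : (S.card : ℤ) = s
      · obtain ⟨u, hu⟩ := exists_homog_lift hψ (mem_coc.1 (hvc S)).2
        exact ⟨u, hu, fun h => absurd hS h⟩
      · exact ⟨0, ⟨map_zero _, by rw [map_zero, (cardProj_self_iff (R := R)).1 hv S hS]⟩, fun _ => rfl⟩
    obtain ⟨e, he, heP⟩ := exists_family (R := R) (P := fun S u => u ∈ coc y N (rs.length + 1) ∧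
        x • u = cd y N (v' S)) s fun S => by
      by_cases hS : (S.card : ℤ) = s
      · obtain ⟨u, hu, hu'⟩ := exists_homog_preimage (exact_smul_mkQ x N) (k := rs.length + 1)
          (v := cd y N (v' S)) (by rw [cdeg_cd, (hv'P S).1])
          (by rw [cmap_cd]; erw [(hv'P S).2]; exact (mem_coc.1 (hvc S)).1)
        rw [cmap_smul_id] at hu'
        refine ⟨u, ⟨mem_coc.2 ⟨smul_cech_injective hreg ?_, hu⟩, hu'⟩, fun h => absurd hS h⟩
        rw [← map_smul, hu', cd_cd, smul_zero]
      · refine ⟨0, ⟨zero_mem _, ?_⟩, fun _ => rfl⟩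
        rw [(cardProj_self_iff (R := R)).1 hv' S hS, map_zero, smul_zero]
    obtain ⟨g, hg, hgc, hgb⟩ := exists_smul_sub_kbd_mem (P := coc y N (rs.length + 1))
      (Q := LinearMap.range (cd y N)) hx (f := w' - e) (s := s) (by rw [map_sub, hw', he])
      (fun S => sub_mem (hw'P S).1 (heP S).1) fun S => by
        obtain ⟨q, hq⟩ := hvb S
        obtain ⟨q, rfl⟩ := cmap_surjective hψ q
        have h1 := congrFun (kbd_map y (cmap y ψ) v') S
        simp only [(hv'P _).2] at h1
        obtain ⟨c, hc⟩ := (cmap_exact (exact_smul_mkQ x N) (b S - kbd y _ v' S - cd y N q)).1 (by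
          rw [map_sub, map_sub, cmap_cd]
          erw [hq, ← h1]
          exact sub_self _)
        rw [cmap_smul_id] at hc
        refine ⟨c, smul_cech_injective hreg ?_⟩
        rw [← map_smul, hc, map_sub, map_sub, cd_cd, sub_zero, (hbP S).2, map_sub,
          Pi.sub_apply, smul_sub]
        have h2 := congrFun (kbd_map y (cd y N) v') S
        have h3 : (fun S => cd y N (v' S)) = x • e := funext fun S => (heP S).2.symm
        rw [h3, map_smul] at h2
        rw [← h2, Pi.smul_apply]
    refine ⟨g, hg, hgc, fun S => ?_⟩
    have h4 : w S - kbd y _ g S =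
        (w S - x • w' S) + x • e S + (x • (w' - e) S - kbd y _ g S) := by
      rw [Pi.sub_apply, smul_sub]
      abel
    rw [h4]
    exact add_mem (add_mem (hw'P S).2 ⟨_, (heP S).2.symm⟩) (hgb S)

end KoszulHomology

section KoszulChase

open Cech

variable {N N' : Type} [AddCommGroup N'] [Module R N'] [AddCommGroup N] [Module R N]

/-- Exactness of the Koszul complex of `y` on `N` in degree `s`. -/
def KExact (N : Type) [AddCommGroup N] [Module R N] (s : ℤ) : Prop :=
  ∀ w, cardProj R n N s w = w → kbd y N w = 0 →
    ∃ v, cardProj R n N (s + 1) v = v ∧ kbd y N v = w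

variable {y} {e : Fin n → ℤ}

namespace GrProj

/-- The operators induced on Koszul chains. -/
def chains (G : GrProj y e N) (ℓ : ℤ) : (Finset (Fin n) → N) →+ (Finset (Fin n) → N) where
  toFun f S := G.p (ℓ - ∑ j ∈ S, e j) (f S)
  map_zero' := by ext S; simp
  map_add' f g := by ext S; simp

lemma chains_apply (G : GrProj y e N) (ℓ : ℤ) (f : Finset (Fin n) → N) (S : Finset (Fin n)) :
    G.chains ℓ f S = G.p (ℓ - ∑ j ∈ S, e j) (f S) := rfl

lemma kbd_chains (G : GrProj y e N) (ℓ : ℤ) (f : Finset (Fin n) → N) :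
    kbd y N (G.chains ℓ f) = G.chains ℓ (kbd y N f) := by
  ext S
  simp only [chains_apply, kbd_eq, Finset.sum_apply, Pi.smul_apply, map_sum, con_apply]
  refine Finset.sum_congr rfl fun j _ => ?_
  by_cases hj : j ∈ S
  · simp [hj]
  · simp only [hj, if_false]
    rw [smul_comm, smul_comm _ (ksign j S), map_zsmul, ← p_smul, Finset.sum_insert hj]
    congr 3
    ring

lemma cardProj_chains (G : GrProj y e N) (ℓ s : ℤ) {f : Finset (Fin n) → N}
    (hf : cardProj R n N s f = f) : cardProj R n N s (G.chains ℓ f) = G.chains ℓ f := by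
  rw [cardProj_self_iff] at hf ⊢
  intro S hS
  rw [chains_apply, hf S hS, map_zero]

lemma chains_map {G : GrProj y e N} {G' : GrProj y e N'} {φ : N →ₗ[R] N'}
    (h : ∀ ℓ x, φ (G.p ℓ x) = G'.p ℓ (φ x)) (ℓ : ℤ) (f : Finset (Fin n) → N) :
    (fun S => φ (G.chains ℓ f S)) = G'.chains ℓ fun S => φ (f S) := by
  ext S
  rw [chains_apply, chains_apply, h]

end GrProj

section Chase

variable (D : ℕ → Type) [∀ j, AddCommGroup (D j)] [∀ j, Module R (D j)]
  (δ : ∀ j, D (j + 1) →ₗ[R] D j) (G : ∀ j, GrProj y e (D j))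

lemma koszul_chase_aux (hδ : ∀ j x, δ j (δ (j + 1) x) = 0)
    (hG : ∀ j ℓ x, δ j ((G (j + 1)).p ℓ x) = (G j).p ℓ (δ j x)) (d t : ℕ)
    (htd : t ≤ d) (hex : ∀ j, j ≤ d → ∀ s : ℤ, s < d → KExact y (D j) s)
    (hexact : ∀ j, d ≤ j + t → j + 1 < d → ∀ x, δ j x = 0 → ∃ x', δ (j + 1) x' = x)
    (b ℓ : ℤ) (hb : ∀ j, j + t = d → ∀ ℓ' > b, ∀ x, (G j).p ℓ' x = 0)
    (hℓ : ∀ S : Finset (Fin n), S.card = t → b < ℓ - ∑ j ∈ S, e j) (m : ℕ) :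
    ∀ s j : ℕ, m + s + 1 = t → j + s + 1 = d → ∀ z : Finset (Fin n) → D (j + 1),
      cardProj R n _ s z = z → kbd y _ z = 0 → (∀ S, δ j (z S) = 0) →
      ∃ v, cardProj R n _ (s + 1) v = v ∧ kbd y _ v = (G (j + 1)).chains ℓ z ∧
        ∀ S, δ j (v S) = 0 := by
  induction m with
  | zero =>
    intro s j hm hj z hz hz0 hδz
    obtain ⟨v, hv, rfl⟩ := hex (j + 1) (by omega) s (by omega) z hz hz0
    refine ⟨(G (j + 1)).chains ℓ v, GrProj.cardProj_chains _ _ _ hv, GrProj.kbd_chains _ _ _,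
      fun S => ?_⟩
    rw [GrProj.chains_apply]
    by_cases hS : (S.card : ℤ) = s + 1
    · rw [hG]
      exact hb j (by omega) _ (hℓ S (by omega)) _
    · rw [(cardProj_self_iff (R := R)).1 hv S hS, map_zero, map_zero]
  | succ m ih =>
    intro s j hm hj z hz hz0 hδz
    obtain ⟨j, rfl⟩ : ∃ i, j = i + 1 := ⟨j - 1, by omega⟩
    obtain ⟨v, hv, rfl⟩ := hex (j + 2) (by omega) s (by omega) z hz hz0
    have hku : kbd y _ (fun S => δ (j + 1) (v S)) = 0 := by
      rw [kbd_map]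
      exact funext hδz
    obtain ⟨u, hu, hku', hδu⟩ := ih (s + 1) j (by omega) (by omega) (fun S => δ (j + 1) (v S))
      (by push_cast; exact cardProj_map _ hv) hku fun S => hδ _ _
    obtain ⟨r, hr, hr'⟩ := exists_family (R := R) (P := fun S x => δ (j + 1) x = u S)
      ((s + 1 : ℕ) + 1 : ℤ) fun S => by
        by_cases hS : (S.card : ℤ) = (s + 1 : ℕ) + 1
        · obtain ⟨x, hx⟩ := hexact j (by omega) (by omega) (u S) (hδu S)
          exact ⟨x, hx, fun h => absurd hS h⟩
        · exact ⟨0, by rw [map_zero, (cardProj_self_iff (R := R)).1 hu S hS], fun _ => rfl⟩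
    refine ⟨(G (j + 2)).chains ℓ v - kbd y _ r, ?_, ?_, fun S => ?_⟩
    · rw [map_sub, GrProj.cardProj_chains _ _ _ hv, cardProj_kbd]
      push_cast at hr
      rw [hr]
    · rw [map_sub, kbd_kbd, sub_zero, GrProj.kbd_chains]
    · have h1 := congrFun (GrProj.chains_map (hG (j + 1)) ℓ v) S
      have h2 := congrFun (kbd_map y (δ (j + 1)) r) S
      simp only [hr'] at h2
      rw [Pi.sub_apply, map_sub, ← h2, hku', ← h1, sub_self]

/-- The key Koszul chase: homogeneous cycles of large degree in the last term of a complex whose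
terms have acyclic Koszul complexes are combinations of cycles with coefficients `y j`. -/
lemma koszul_chase (hδ : ∀ j x, δ j (δ (j + 1) x) = 0)
    (hG : ∀ j ℓ x, δ j ((G (j + 1)).p ℓ x) = (G j).p ℓ (δ j x)) (d t : ℕ)
    (ht : 1 ≤ t) (htd : t ≤ d) (hex : ∀ j, j ≤ d → ∀ s : ℤ, s < d → KExact y (D j) s)
    (hexact : ∀ j, d ≤ j + t → j + 1 < d → ∀ x, δ j x = 0 → ∃ x', δ (j + 1) x' = x)
    (b ℓ : ℤ) (hb : ∀ j, j + t = d → ∀ ℓ' > b, ∀ x, (G j).p ℓ' x = 0)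
    (hℓ : ∀ S : Finset (Fin n), S.card = t → b < ℓ - ∑ j ∈ S, e j) (j : ℕ) (hj : j + 1 = d)
    (x : D (j + 1)) (hx : δ j x = 0) :
    ∃ ζ : Fin n → D (j + 1), (∀ i, δ j (ζ i) = 0) ∧ (G (j + 1)).p ℓ x = ∑ i, y i • ζ i := by
  obtain ⟨v, -, hv, hδv⟩ := koszul_chase_aux D δ G hδ hG d t htd hex hexact b ℓ hb hℓ (t - 1) 0 j
    (by omega) (by omega) (fun S => if S = ∅ then x else 0)
    ((cardProj_self_iff (R := R)).2 fun S hS => by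
      rw [if_neg]
      rintro rfl
      simp at hS)
    (by
      ext S
      rw [kbd_eq, Finset.sum_apply, Pi.zero_apply]
      refine Finset.sum_eq_zero fun i _ => ?_
      simp [con_apply])
    (fun S => by split_ifs <;> simp [hx])
  refine ⟨fun i => v {i}, fun i => hδv _, ?_⟩
  have h := congrFun hv ∅
  rw [GrProj.chains_apply, kbd_eq, Finset.sum_apply] at h
  simpa [con_apply, ksign] using h.symm

end Chase

/-- The `k`-th Čech cohomology. -/
def CechH (y : Fin n → R) (N : Type) [AddCommGroup N] [Module R N] (k : ℤ) : Type :=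
  coc y N k ⧸ (LinearMap.range (cd y N)).comap (coc y N k).subtype

namespace CechH

instance (k : ℤ) : AddCommGroup (CechH y N k) :=
  inferInstanceAs (AddCommGroup (coc y N k ⧸ (LinearMap.range (cd y N)).comap (coc y N k).subtype))

instance (k : ℤ) : Module R (CechH y N k) :=
  inferInstanceAs (Module R (coc y N k ⧸ (LinearMap.range (cd y N)).comap (coc y N k).subtype))

/-- The cohomology class of a cocycle. -/
def cls (y : Fin n → R) (N : Type) [AddCommGroup N] [Module R N] (k : ℤ) :
    coc y N k →ₗ[R] CechH y N k :=
  ((LinearMap.range (cd y N)).comap (coc y N k).subtype).mkQ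

lemma cls_surjective (k : ℤ) : Function.Surjective (cls y N k) := Submodule.mkQ_surjective _

lemma cls_eq_zero {k : ℤ} {z : coc y N k} :
    cls y N k z = 0 ↔ (z : Cech y N) ∈ LinearMap.range (cd y N) :=
  Submodule.Quotient.mk_eq_zero _

/-- The map on cohomology induced by a linear map. -/
def map (φ : N →ₗ[R] N') (k : ℤ) : CechH y N k →ₗ[R] CechH y N' k :=
  Submodule.mapQ _ _ ((cmap y φ).restrict fun _ hz => cmap_mem_coc φ hz) <| by
    rintro ⟨z, hz⟩ ⟨w, hw⟩
    exact ⟨cmap y φ w, by rw [← cmap_cd, hw]; rfl⟩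

lemma map_cls (φ : N →ₗ[R] N') (k : ℤ) (z : coc y N k) :
    map φ k (cls y N k z) = cls y N' k ⟨cmap y φ z, cmap_mem_coc φ z.2⟩ := rfl

end CechH

open CechH

/-- The operators induced on Čech cohomology. -/
def GrProj.cechH (G : GrProj y e N) (k : ℤ) : GrProj y e (CechH y N k) :=
  (G.cech.sub (coc y N k) fun ℓ z hz => by
    rw [mem_coc] at hz ⊢
    rw [← GrProj.cech_cd, hz.1, map_zero, ← GrProj.cech_cdeg, hz.2]
    exact ⟨rfl, rfl⟩).quot _ <| by
    rintro ℓ ⟨z, hz⟩ ⟨w, hw⟩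
    exact ⟨G.cech.p ℓ w, by rw [← GrProj.cech_cd, hw]; rfl⟩

lemma GrProj.cech_mem_coc (G : GrProj y e N) (ℓ : ℤ) {k : ℤ} {z : Cech y N}
    (hz : z ∈ coc y N k) : G.cech.p ℓ z ∈ coc y N k := by
  rw [mem_coc] at hz ⊢
  rw [← GrProj.cech_cd, hz.1, map_zero, ← GrProj.cech_cdeg, hz.2]
  exact ⟨rfl, rfl⟩

lemma GrProj.cechH_cls (G : GrProj y e N) (k ℓ : ℤ) (z : coc y N k) :
    (G.cechH k).p ℓ (cls y N k z) = cls y N k ⟨G.cech.p ℓ z, G.cech_mem_coc ℓ z.2⟩ := rfl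

lemma GrProj.cechH_map {G : GrProj y e N} {G' : GrProj y e N'} {φ : N →ₗ[R] N'}
    (h : ∀ ℓ x, φ (G.p ℓ x) = G'.p ℓ (φ x)) (k ℓ : ℤ) (x : CechH y N k) :
    CechH.map φ k ((G.cechH k).p ℓ x) = (G'.cechH k).p ℓ (CechH.map φ k x) := by
  obtain ⟨z, rfl⟩ := cls_surjective k x
  rw [cechH_cls, map_cls, map_cls, cechH_cls]
  congr 2
  exact cech_cmap₀ h ℓ z

/-- The Koszul complex of the top local cohomology of a Cohen-Macaulay module is exact below the
dimension. -/
lemma KExact.cechH [IsNoetherianRing R] (rs : List R)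
    (hrs : ∀ r ∈ rs, r ∈ Ideal.span (Set.range y)) (N : Type) [AddCommGroup N] [Module R N]
    [Module.Finite R N] (h : RingTheory.Sequence.IsWeaklyRegular N rs)
    (hdim : Module.supportDim R N < ((rs.length + 1 : ℕ) : WithBot ℕ∞)) (s : ℤ)
    (hs : s < rs.length) : KExact y (CechH y N rs.length) s := by
  intro w hw hw0
  obtain ⟨w', hw', hcls⟩ := exists_family (R := R)
    (P := fun S z => cls y N rs.length z = w S) s fun S => by
      by_cases hS : (S.card : ℤ) = s
      · obtain ⟨z, hz⟩ := cls_surjective rs.length (w S)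
        exact ⟨z, hz, fun h => absurd hS h⟩
      · exact ⟨0, by rw [map_zero, (cardProj_self_iff (R := R)).1 hw S hS], fun _ => rfl⟩
  have hcoe : ∀ u : Finset (Fin n) → coc y N rs.length,
      kbd y (Cech y N) (fun S => (u S : Cech y N)) =
        fun S => ((kbd y (coc y N rs.length) u S : coc y N rs.length) : Cech y N) :=
    kbd_map y (coc y N rs.length).subtype
  have hclsk := kbd_map y (cls y N rs.length)
  obtain ⟨v, hv, hvc, hvb⟩ := exists_kbd_of_isWeaklyRegular rs hrs N h hdim s hs
    (fun S => (w' S : Cech y N)) (cardProj_map (coc y N rs.length).subtype hw') (fun S => (w' S).2)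
    (fun S => by
      rw [hcoe, ← cls_eq_zero]
      have := congrFun (hclsk w') S
      simp only [hcls] at this
      rw [← this, hw0, Pi.zero_apply])
  refine ⟨fun S => cls y N rs.length ⟨v S, hvc S⟩, (cardProj_self_iff (R := R)).2 fun S hS => ?_, ?_⟩
  · rw [cls_eq_zero]
    change v S ∈ _
    rw [(cardProj_self_iff (R := R)).1 hv S hS]
    exact zero_mem _
  · rw [hclsk]
    ext S
    rw [← hcls, eq_comm, ← sub_eq_zero, ← map_sub, cls_eq_zero]
    have := congrFun (hcoe fun S => ⟨v S, hvc S⟩) S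
    rw [AddSubgroupClass.coe_sub, ← this]
    exact hvb S

end KoszulChase

section Complex

open Cech

variable {y} {e : Fin n → ℤ}
variable (C : ℕ → Type) [∀ j, AddCommGroup (C j)] [∀ j, Module R (C j)]
  (dl : ∀ j, C (j + 1) →ₗ[R] C j)

/-- The cokernel of the differential with values in `C j`. -/
abbrev Cok (j : ℕ) : Type := C j ⧸ LinearMap.range (dl j)

/-- The inclusion of homology into the cokernel. -/
def homologyToCok (j : ℕ) : Hmod C dl j →ₗ[R] Cok C dl (j + 1) :=
  Submodule.mapQ _ _ (LinearMap.ker (dl j)).subtype le_rfl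

lemma homologyToCok_injective (j : ℕ) : Function.Injective (homologyToCok C dl j) := by
  rw [injective_iff_map_eq_zero]
  intro x hx
  obtain ⟨x, rfl⟩ := Submodule.Quotient.mk_surjective _ x
  exact (Submodule.Quotient.mk_eq_zero _).2
    ((Submodule.Quotient.mk_eq_zero (LinearMap.range (dl (j + 1)))).1 hx)

variable (hδ : ∀ j x, dl j (dl (j + 1) x) = 0)

/-- The map from the cokernel to the boundaries induced by the differential. -/
def cokToRange (j : ℕ) : Cok C dl (j + 1) →ₗ[R] LinearMap.range (dl j) :=
  Submodule.liftQ _ (dl j).rangeRestrict <| by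
    rintro _ ⟨x, rfl⟩
    exact Subtype.ext (hδ j x)

lemma cokToRange_surjective (j : ℕ) : Function.Surjective (cokToRange C dl hδ j) := by
  rintro ⟨_, x, rfl⟩
  exact ⟨Submodule.mkQ _ x, rfl⟩

lemma exact_homologyToCok (j : ℕ) :
    Function.Exact (homologyToCok C dl j) (cokToRange C dl hδ j) := by
  intro x
  obtain ⟨x, rfl⟩ := Submodule.mkQ_surjective _ x
  constructor
  · intro hx
    exact ⟨Submodule.mkQ _ ⟨x, congrArg Subtype.val hx⟩, rfl⟩
  · rintro ⟨z, hz⟩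
    obtain ⟨z, rfl⟩ := Submodule.mkQ_surjective _ z
    rw [← hz]
    exact Subtype.ext z.2

section Grading

variable (G : ∀ j, GrProj y e (C j)) (hG : ∀ j ℓ x, dl j ((G (j + 1)).p ℓ x) = (G j).p ℓ (dl j x))

/-- The operators induced on the cokernels of the differentials. -/
def gradCok (j : ℕ) : GrProj y e (Cok C dl j) :=
  (G j).quot _ <| by
    rintro ℓ _ ⟨x, rfl⟩
    exact ⟨_, hG j ℓ x⟩

/-- The operators induced on the images of the differentials. -/
def gradRange (j : ℕ) : GrProj y e (LinearMap.range (dl j)) :=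
  (G j).sub _ <| by
    rintro ℓ _ ⟨x, rfl⟩
    exact ⟨_, hG j ℓ x⟩

lemma gradCok_mkQ (j : ℕ) (ℓ : ℤ) (x : C j) :
    Submodule.mkQ _ ((G j).p ℓ x) = (gradCok C dl G hG j).p ℓ (Submodule.mkQ _ x) := rfl

lemma gradRange_subtype (j : ℕ) (ℓ : ℤ) (x : LinearMap.range (dl j)) :
    Submodule.subtype _ ((gradRange C dl G hG j).p ℓ x) = (G j).p ℓ (Submodule.subtype _ x) := rfl

lemma gradRange_rangeRestrict (j : ℕ) (ℓ : ℤ) (x : C (j + 1)) :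
    (dl j).rangeRestrict ((G (j + 1)).p ℓ x) =
      (gradRange C dl G hG j).p ℓ ((dl j).rangeRestrict x) :=
  Subtype.ext (hG j ℓ x)

lemma gradRange_cokToRange (j : ℕ) (ℓ : ℤ) (x : Cok C dl (j + 1)) :
    cokToRange C dl hδ j ((gradCok C dl G hG (j + 1)).p ℓ x) =
      (gradRange C dl G hG j).p ℓ (cokToRange C dl hδ j x) := by
  obtain ⟨x, rfl⟩ := Submodule.mkQ_surjective _ x
  exact gradRange_rangeRestrict C dl G hG j ℓ x

lemma Van.cok_of_succ (hδ : ∀ j x, dl j (dl (j + 1) x) = 0) {j : ℕ}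
    {k ℓ : ℤ} (hH : Acyc y (Hmod C dl j) (k + 1 + 1))
    (hC : Acyc y (C j) k) (h : (gradCok C dl G hG (j + 1)).Van (k + 1) ℓ) :
    (gradCok C dl G hG j).Van k ℓ := by
  refine GrProj.Van.of_left (Submodule.injective_subtype _) (Submodule.mkQ_surjective _)
    (LinearMap.exact_subtype_mkQ _) (gradRange_subtype C dl G hG j) (gradCok_mkQ C dl G hG j) hC ?_
  refine GrProj.Van.of_middle (homologyToCok_injective C dl j) (cokToRange_surjective C dl hδ j)
    (exact_homologyToCok C dl hδ j) (gradRange_cokToRange C dl hδ G hG j) hH h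

lemma Gen.cok_of_succ (hδ : ∀ j x, dl j (dl (j + 1) x) = 0) {j : ℕ}
    {k ℓ : ℤ} (hH : Acyc y (Hmod C dl j) (k + 1 + 1))
    (hC : Acyc y (C j) k) (hC' : Acyc y (C j) (k + 1))
    (h : (gradCok C dl G hG (j + 1)).Gen (k + 1) ℓ) :
    (gradCok C dl G hG j).Gen k ℓ := by
  refine GrProj.Gen.of_left (Submodule.injective_subtype _) (Submodule.mkQ_surjective _)
    (LinearMap.exact_subtype_mkQ _) (gradRange_subtype C dl G hG j) (gradCok_mkQ C dl G hG j)
    hC hC' ?_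
  refine GrProj.Gen.of_middle (homologyToCok_injective C dl j) (cokToRange_surjective C dl hδ j)
    (exact_homologyToCok C dl hδ j) (gradRange_cokToRange C dl hδ G hG j) hH h

end Grading

lemma Acyc.cok_succ (hδ : ∀ j x, dl j (dl (j + 1) x) = 0) {j : ℕ}
    {k : ℤ} (hH : Acyc y (Hmod C dl j) (k + 1))
    (hC : Acyc y (C j) (k + 1)) (h : Acyc y (Cok C dl j) k) : Acyc y (Cok C dl (j + 1)) (k + 1) :=
  Acyc.middle (homologyToCok_injective C dl j) (cokToRange_surjective C dl hδ j)
    (exact_homologyToCok C dl hδ j) hH <|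
    Acyc.left (Submodule.injective_subtype _) (Submodule.mkQ_surjective _)
      (LinearMap.exact_subtype_mkQ _) hC (by rwa [add_sub_cancel_right])

/-- Exactness on top local cohomology. -/
lemma CechH.exists_map_eq (hδ : ∀ j x, dl j (dl (j + 1) x) = 0) {j : ℕ}
    {k : ℤ} (hN : Acyc y (Cok C dl j) (k - 1))
    (hH : Acyc y (Hmod C dl j) k)
    (hK : Acyc y (LinearMap.ker (dl (j + 1)).rangeRestrict) (k + 1)) (x : CechH y (C (j + 1)) k)
    (hx : CechH.map (dl j) k x = 0) : ∃ x', CechH.map (dl (j + 1)) k x' = x := by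
  obtain ⟨⟨z, hz⟩, rfl⟩ := CechH.cls_surjective k x
  rw [CechH.map_cls, CechH.cls_eq_zero] at hx
  obtain ⟨hz0, hzk⟩ := mem_coc.1 hz
  have h1 : cmap y (dl j).rangeRestrict z ∈ LinearMap.range (cd y _) :=
    mem_range_of_cmap_mem_range (Submodule.injective_subtype _) (Submodule.mkQ_surjective _)
      (LinearMap.exact_subtype_mkQ _) hN (by rw [← cmap_cdeg, hzk]) (by rwa [← cmap_comp])
  have h2 : cmap y (LinearMap.range (dl (j + 1))).mkQ z ∈ LinearMap.range (cd y _) :=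
    mem_range_of_cmap_mem_range_of_acyc (homologyToCok_injective C dl j)
      (cokToRange_surjective C dl hδ j) (exact_homologyToCok C dl hδ j) hH
      (by rw [← cmap_cdeg, hzk]) (by rw [← cmap_cd, hz0, map_zero]) (by rwa [← cmap_comp])
  obtain ⟨q, hq, hq'⟩ := exists_homog_cd (k := k) (by rw [← cmap_cdeg, hzk]) h2
  obtain ⟨v, hv, rfl⟩ := exists_homog_lift (Submodule.mkQ_surjective _) hq
  obtain ⟨u, hu, hu'⟩ := exists_homog_preimage
    (LinearMap.exact_subtype_mkQ (LinearMap.range (dl (j + 1)))) (k := k)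
    (v := z - cd y (C (j + 1)) v) (by rw [map_sub, hzk, cdeg_cd', hv])
    (by rw [map_sub, cmap_cd, hq', sub_self])
  obtain ⟨w, hw, hw0, rfl⟩ := exists_cocycle_lift (Submodule.injective_subtype _)
    (dl (j + 1)).surjective_rangeRestrict (LinearMap.exact_subtype_ker_map _) hK hu
    (cmap_injective (Submodule.injective_subtype (LinearMap.range (dl (j + 1)))) (by
      rw [cmap_cd, hu', map_sub, hz0, cd_cd, sub_self, map_zero]))
  rw [← cmap_comp] at hu'
  refine ⟨CechH.cls y _ k ⟨w, mem_coc.2 ⟨hw0, hw⟩⟩, ?_⟩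
  rw [CechH.map_cls, ← sub_eq_zero, ← map_sub, CechH.cls_eq_zero]
  refine ⟨-v, ?_⟩
  change _ = cmap y ((LinearMap.range (dl (j + 1))).subtype ∘ₗ (dl (j + 1)).rangeRestrict) w - z
  rw [hu', map_neg]
  abel

lemma Gen.cok_of_cechH (G : ∀ j, GrProj y e (C j))
    (hG : ∀ j ℓ x, dl j ((G (j + 1)).p ℓ x) = (G j).p ℓ (dl j x)) {j : ℕ} {k ℓ : ℤ}
    (hC : Acyc y (C j) k) (hK : Acyc y (LinearMap.ker (dl j).rangeRestrict) (k + 1 + 1))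
    (h : ∀ x, CechH.map (dl j) (k + 1) x = 0 → ∃ ζ : Fin n → CechH y (C (j + 1)) (k + 1),
      (∀ i, CechH.map (dl j) (k + 1) (ζ i) = 0) ∧
        ((G (j + 1)).cechH (k + 1)).p ℓ x = ∑ i, y i • ζ i) :
    (gradCok C dl G hG j).Gen k ℓ := by
  refine GrProj.Gen.of_connecting (Submodule.injective_subtype _) (Submodule.mkQ_surjective _)
    (LinearMap.exact_subtype_mkQ _) (gradRange_subtype C dl G hG j) (gradCok_mkQ C dl G hG j) hC ?_
  intro u hu hu0 huv
  obtain ⟨v, hv, hv0, rfl⟩ := exists_cocycle_lift (Submodule.injective_subtype _)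
    (dl j).surjective_rangeRestrict (LinearMap.exact_subtype_ker_map _) hK hu hu0
  rw [← cmap_comp] at huv
  obtain ⟨ζ, hζ, hx⟩ := h (CechH.cls y _ _ ⟨v, mem_coc.2 ⟨hv0, hv⟩⟩)
    (by rw [CechH.map_cls, CechH.cls_eq_zero]; exact huv)
  choose z hz using fun i => CechH.cls_surjective (k + 1) (ζ i)
  simp only [← hz, CechH.map_cls, CechH.cls_eq_zero] at hζ
  refine ⟨fun i => cmap y (dl j).rangeRestrict (z i), fun i => ⟨?_, ?_⟩, ?_⟩
  · rw [← cmap_cdeg, (mem_coc.1 (z i).2).2]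
  · rw [← cmap_comp]
    exact hζ i
  · simp only [← hz, ← map_smul, ← map_sum] at hx
    rw [GrProj.cechH_cls, ← sub_eq_zero, ← map_sub, CechH.cls_eq_zero] at hx
    obtain ⟨q, hq⟩ := hx
    refine ⟨cmap y (dl j).rangeRestrict q, ?_⟩
    rw [← cmap_cd, hq, ← GrProj.cech_cmap₀ (gradRange_rangeRestrict C dl G hG j)]
    simp only [AddSubgroupClass.coe_sub, AddSubmonoidClass.coe_finsetSum, Submodule.coe_smul,
      map_sub, map_sum, map_smul]

end Complex

section Main

open Cech

variable {y} {e : Fin n → ℤ}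

section

variable {N : Type} [AddCommGroup N] [Module R N] {I : Ideal R} {d : ℕ}

lemma Acyc.of_depthGE (hI : Ideal.span (Set.range y) = I) (h : depthGE I N d) {k : ℤ}
    (hk : k < d) : Acyc y N k := by
  obtain h | ⟨rs, rfl, hrs, h⟩ := h
  · exact Acyc.of_subsingleton k
  · exact Acyc.of_isWeaklyRegular rs (fun r hr => hI ▸ hrs r hr) N h.toIsWeaklyRegular k hk

lemma Acyc.of_modDimLE [IsNoetherianRing R] [Module.Finite R N] (h : modDimLE (R := R) N d) {k : ℤ}
    (hk : d < k) : Acyc y N k := by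
  refine Acyc.of_supportDim_lt (d + 1) N ?_ k (by push_cast; omega)
  rw [Module.supportDim_eq_ringKrullDim_quotient_annihilator]
  exact lt_of_le_of_lt h ((Nat.cast_lt (α := WithBot ℕ∞)).2 d.lt_succ_self)

lemma Acyc.of_ringKrullDim [IsNoetherianRing R] [Module.Finite R N]
    (h : ringKrullDim R = (d : WithBot (WithTop ℕ))) {k : ℤ} (hk : d < k) : Acyc y N k :=
  Acyc.of_modDimLE ((ringKrullDim_quotient_le _).trans_eq h) hk

lemma KExact.of_depthGE [IsNoetherianRing R] [Module.Finite R N]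
    (hdim : ringKrullDim R = (d : WithBot (WithTop ℕ))) (hI : Ideal.span (Set.range y) = I)
    (h : depthGE I N d) {s : ℤ} (hs : s < d) : KExact y (CechH y N d) s := by
  obtain h | ⟨rs, rfl, hrs, h⟩ := h
  · have : Subsingleton (CechH y N d) := by
      refine subsingleton_of_forall_eq 0 fun x => ?_
      obtain ⟨z, rfl⟩ := CechH.cls_surjective _ x
      rw [CechH.cls_eq_zero]
      exact Acyc.of_subsingleton _ _ (mem_coc.1 z.2).2 (mem_coc.1 z.2).1
    exact fun w _ _ => ⟨0, Subsingleton.elim _ _, Subsingleton.elim _ _⟩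
  · refine KExact.cechH rs (fun r hr => hI ▸ hrs r hr) N h.toIsWeaklyRegular ?_ s hs
    refine ((Module.supportDim_le_ringKrullDim R N).trans_eq hdim).trans_lt ?_
    exact (Nat.cast_lt (α := WithBot ℕ∞)).2 (Nat.lt_succ_self _)

lemma Acyc.of_quotient_torsionSubmodule (hI : Ideal.span (Set.range y) = I)
    (h : depthGE I (N ⧸ torsionSubmodule I N) d) {k : ℤ} (hk : 0 < k) (hkd : k < d) :
    Acyc y N k := by
  refine Acyc.middle (Submodule.injective_subtype _) (Submodule.mkQ_surjective _)
    (LinearMap.exact_subtype_mkQ (torsionSubmodule I N)) (Acyc.of_torsion (fun v j => ?_) hk)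
    (Acyc.of_depthGE hI h hkd)
  obtain ⟨⟨v, s, hs⟩, rfl⟩ : ∃ w, w = v := ⟨v, rfl⟩
  refine ⟨s, Subtype.ext (hs _ (Ideal.pow_mem_pow ?_ s))⟩
  exact hI ▸ Ideal.subset_span ⟨j, rfl⟩

lemma GrProj.Van.of_equiv {N' : Type} [AddCommGroup N'] [Module R N'] {G : GrProj y e N}
    {G' : GrProj y e N'} (φ : N ≃ₗ[R] N') (hφ : ∀ ℓ x, φ (G.p ℓ x) = G'.p ℓ (φ x)) {k ℓ : ℤ}
    (h : G.Van k ℓ) : G'.Van k ℓ :=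
  GrProj.Van.of_middle (X := PUnit) (φ := (0 : PUnit →ₗ[R] N)) (ψ := φ.toLinearMap)
    (Function.injective_of_subsingleton _) φ.surjective (fun x => by simpa using eq_comm) hφ
    (Acyc.of_subsingleton _) h

lemma GrProj.Gen.of_equiv {N' : Type} [AddCommGroup N'] [Module R N'] {G : GrProj y e N}
    {G' : GrProj y e N'} (φ : N ≃ₗ[R] N') (hφ : ∀ ℓ x, φ (G.p ℓ x) = G'.p ℓ (φ x)) {k ℓ : ℤ}
    (h : G.Gen k ℓ) : G'.Gen k ℓ :=
  GrProj.Gen.of_middle (X := PUnit) (φ := (0 : PUnit →ₗ[R] N)) (ψ := φ.toLinearMap)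
    (Function.injective_of_subsingleton _) φ.surjective (fun x => by simpa using eq_comm) hφ
    (Acyc.of_subsingleton _) h

end

section Chain

variable (C : ℕ → Type) [∀ j, AddCommGroup (C j)] [∀ j, Module R (C j)]
  (dl : ∀ j, C (j + 1) →ₗ[R] C j)
  (G : ∀ j, GrProj y e (C j)) (hG : ∀ j ℓ x, dl j ((G (j + 1)).p ℓ x) = (G j).p ℓ (dl j x))
  {d i t : ℕ}

lemma Van.cok_zero (hδ : ∀ j x, dl j (dl (j + 1) x) = 0)
    (hC : ∀ (j : ℕ) (k : ℤ), j + i ≤ d + t → k < d → Acyc y (C j) k)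
    (hH : ∀ (j : ℕ) (k : ℤ), j + i + 2 ≤ d + t → (i + j + 2 : ℤ) ≤ k + t →
      Acyc y (Hmod C dl j) k)
    (ht : 1 ≤ t) {ℓ : ℤ} (m : ℕ) (hm : m + i ≤ d)
    (h : (gradCok C dl G hG m).Van (m + i) ℓ) : (gradCok C dl G hG 0).Van i ℓ := by
  induction m with
  | zero => simpa using h
  | succ m ih =>
    refine ih (by omega) (Van.cok_of_succ C dl G hG hδ (hH _ _ (by omega) (by omega))
      (hC _ _ (by omega) (by omega)) ?_)
    convert h using 1
    push_cast
    ring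

lemma Gen.cok_zero (hδ : ∀ j x, dl j (dl (j + 1) x) = 0)
    (hC : ∀ (j : ℕ) (k : ℤ), j + i ≤ d + t → k < d → Acyc y (C j) k)
    (hH : ∀ (j : ℕ) (k : ℤ), j + i + 2 ≤ d + t → (i + j + 2 : ℤ) ≤ k + t →
      Acyc y (Hmod C dl j) k)
    (hit : i = t) {ℓ : ℤ} (m : ℕ) (hm : m + 1 ≤ d)
    (h : (gradCok C dl G hG m).Gen m ℓ) : (gradCok C dl G hG 0).Gen 0 ℓ := by
  induction m with
  | zero => simpa using h
  | succ m ih =>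
    exact ih (by omega) (Gen.cok_of_succ C dl G hG hδ (hH _ _ (by omega) (by omega))
      (hC _ _ (by omega) (by omega)) (hC _ _ (by omega) (by omega)) (by exact_mod_cast h))

lemma Acyc.cok (hδ : ∀ j x, dl j (dl (j + 1) x) = 0)
    (hC : ∀ (j : ℕ) (k : ℤ), j + i ≤ d + t → k < d → Acyc y (C j) k)
    (hH : ∀ (j : ℕ) (k : ℤ), j + i + 2 ≤ d + t → (i + j + 2 : ℤ) ≤ k + t →
      Acyc y (Hmod C dl j) k)
    (hit : i = t) {k : ℤ} (hk : 1 ≤ k) (h0 : Acyc y (Cok C dl 0) k) (m : ℕ)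
    (hm : k + m < d) : Acyc y (Cok C dl m) (k + m) := by
  induction m with
  | zero => simpa using h0
  | succ m ih =>
    have := Acyc.cok_succ C dl hδ (hH m (k + m + 1) (by omega) (by omega))
      (hC m (k + m + 1) (by omega) (by omega)) (ih (by omega))
    push_cast
    rwa [← add_assoc]

lemma Gen.cok_zero_of_van (hδ : ∀ j x, dl j (dl (j + 1) x) = 0)
    (hC : ∀ (j : ℕ) (k : ℤ), j + i ≤ d + t → k < d → Acyc y (C j) k)
    (hH : ∀ (j : ℕ) (k : ℤ), j + i + 2 ≤ d + t → (i + j + 2 : ℤ) ≤ k + t →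
      Acyc y (Hmod C dl j) k)
    [IsNoetherianRing R] [∀ j, Module.Finite R (C j)] (hit : i = t)
    (ht : 1 ≤ t) (htd : t ≤ d)
    (hdim : ringKrullDim R = (d : WithBot (WithTop ℕ)))
    (hK : ∀ j : ℕ, j ≤ d → ∀ s : ℤ, s < d → KExact y (CechH y (C j) d) s)
    (h0 : ∀ k : ℤ, 0 < k → k < t → Acyc y (Cok C dl 0) k) {b ℓ : ℤ}
    (hb : ∀ j, j + t = d → ∀ ℓ', b < ℓ' → (G j).Van d ℓ')
    (hℓ : ∀ S : Finset (Fin n), S.card = t → b < ℓ - ∑ j ∈ S, e j) :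
    (gradCok C dl G hG 0).Gen 0 ℓ := by
  obtain ⟨m, rfl⟩ : ∃ m, d = m + 1 := ⟨d - 1, by omega⟩
  refine Gen.cok_zero C dl G hG hδ hC hH hit m le_rfl ?_
  refine Gen.cok_of_cechH C dl G hG (hC _ _ (by omega) (by omega))
    (Acyc.of_ringKrullDim hdim (by omega)) ?_
  have := koszul_chase (fun j => CechH y (C j) ((m + 1 : ℕ) : ℤ))
    (fun j => CechH.map (dl j) _) (fun j => (G j).cechH _) (fun j x => ?_)
    (fun j ℓ x => GrProj.cechH_map (hG j) _ _ _) (m + 1) t ht htd hK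
    (fun j hj hjd => CechH.exists_map_eq C dl hδ ?_ (hH _ _ (by omega) (by omega))
      (Acyc.of_ringKrullDim hdim (by omega))) b ℓ (fun j hj ℓ' hℓ' x => ?_) hℓ m rfl
  · exact_mod_cast this
  · obtain ⟨z, rfl⟩ := CechH.cls_surjective _ x
    rw [CechH.map_cls, CechH.map_cls, CechH.cls_eq_zero]
    change cmap y (dl j) (cmap y (dl (j + 1)) z) ∈ _
    rw [← cmap_comp, show (dl j).comp (dl (j + 1)) = 0 from LinearMap.ext (hδ j), cmap_zero]
    exact zero_mem _
  · have := Acyc.cok C dl hδ hC hH hit (k := (m - j : ℤ)) (by omega)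
      (h0 _ (by omega) (by omega)) j (by omega)
    convert this using 1
    push_cast
    ring
  · obtain ⟨z, rfl⟩ := CechH.cls_surjective _ x
    rw [GrProj.cechH_cls, CechH.cls_eq_zero]
    exact hb j hj ℓ' hℓ' z (mem_coc.1 z.2).2 (mem_coc.1 z.2).1

end Chain

end Main

section Comparison

open Cech

variable {N : Type} [AddCommGroup N] [Module R N] {k : ℕ}

/-- The extension by zero of a Koszul cochain to all subsets. -/
def extend (f : KCochain n N k) (S : Finset (Fin n)) : N := if h : S.card = k then f ⟨S, h⟩ else 0

lemma extend_apply (f : KCochain n N k) (S : {S : Finset (Fin n) // S.card = k}) :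
    extend f S.1 = f S := dif_pos S.2

lemma extend_of_ne (f : KCochain n N k) {S : Finset (Fin n)} (hS : S.card ≠ k) :
    extend f S = 0 := dif_neg hS

lemma extend_injective : Function.Injective (extend : KCochain n N k → Finset (Fin n) → N) := by
  intro f g h
  ext S
  rw [← extend_apply f, h, extend_apply]

lemma cardProj_extend (f : KCochain n N k) : cardProj R n N k (extend f) = extend f :=
  cardProj_self_iff.2 fun S hS => extend_of_ne f (by exact_mod_cast hS)

lemma ktr_extend (s : ℕ) (f : KCochain n N k) : ktr y N s (extend f) = extend (kTrans y s k f) := by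
  ext S
  rw [ktr_apply]
  by_cases hS : S.card = k
  · rw [extend, extend, dif_pos hS, dif_pos hS]
    rfl
  · rw [extend_of_ne _ hS, extend_of_ne _ hS, smul_zero]

lemma kcd_extend (t : ℕ) (f : KCochain n N k) :
    kcd y N t (extend f) = extend (kd y t k f) := by
  ext S
  rw [kcd_eq, Finset.sum_apply]
  by_cases hS : S.card = k + 1
  · rw [extend, dif_pos hS, kd, ← Finset.sum_subset (Finset.subset_univ S), ← Finset.sum_attach]
    · refine Finset.sum_congr rfl fun j _ => ?_
      rw [Pi.smul_apply, cre_apply, if_pos j.2, smul_comm, extend, dif_pos]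
      rfl
    · intro j _ hj
      rw [Pi.smul_apply, cre_apply, if_neg hj, smul_zero]
  · rw [extend_of_ne _ hS]
    refine Finset.sum_eq_zero fun j _ => ?_
    rw [Pi.smul_apply, cre_apply]
    split_ifs with hj
    · rw [extend_of_ne _ (by rw [Finset.card_erase_of_mem hj]; have := Finset.card_pos.2 ⟨j, hj⟩; omega),
        smul_zero, smul_zero]
    · rw [smul_zero]

variable {y}

lemma exists_mk_extend {z : Cech y N} (hz : cdeg y N k z = z) :
    ∃ t, ∃ f : KCochain n N k, z = mk y N t (extend f) := by
  obtain ⟨t, F, rfl⟩ := exists_mk z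
  refine ⟨t, fun S => F S.1, ?_⟩
  rw [← hz, cdeg_mk]
  congr 1
  ext S
  rw [cardProj_apply, extend]
  simp only [Nat.cast_inj, dite_eq_ite]

lemma cdeg_mk_extend (t : ℕ) (f : KCochain n N k) :
    cdeg y N k (mk y N t (extend f)) = mk y N t (extend f) := by
  rw [cdeg_mk, cardProj_extend]

lemma cd_mk_extend (t : ℕ) (f : KCochain n N k) :
    cd y N (mk y N t (extend f)) = mk y N t (extend (kd y t k f)) := by
  rw [cd_mk, kcd_extend]

lemma mk_extend_eq_zero {t : ℕ} {f : KCochain n N k} :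
    mk y N t (extend f) = 0 ↔ ∃ s, kTrans y s k f = 0 := by
  simp only [mk_eq_zero, ktr_extend]
  have h0 : extend (0 : KCochain n N k) = 0 := by
    ext S
    simp [extend]
  simp only [← h0, extend_injective.eq_iff]

lemma kTrans_kTrans (s s' : ℕ) (f : KCochain n N k) :
    kTrans y s' k (kTrans y s k f) = kTrans y (s + s') k f :=
  extend_injective (by simp only [← ktr_extend, ktr_ktr])

lemma kd_kTrans (t s : ℕ) (f : KCochain n N k) :
    kd y (t + s) k (kTrans y s k f) = kTrans y s (k + 1) (kd y t k f) :=
  extend_injective (by simp only [← ktr_extend, ← kcd_extend, ktr_kcd])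

lemma mk_extend_mem_range_iff (t : ℕ) (f : KCochain n N k) :
    mk y N t (extend f) ∈ LinearMap.range (cd y N) ↔
      ∃ s, IsKBoundary y (t + s) k (kTrans y s k f) := by
  constructor
  · intro h
    obtain ⟨w, hw, hw'⟩ := exists_homog_cd (cdeg_mk_extend t f) h
    cases k with
    | zero =>
      rw [cdeg_of_neg (by simp)] at hw
      rw [← hw, map_zero, eq_comm, mk_extend_eq_zero] at hw'
      exact hw'
    | succ k =>
      rw [Nat.cast_succ, add_sub_cancel_right] at hw
      obtain ⟨t', g, rfl⟩ := exists_mk_extend hw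
      rw [cd_mk_extend, ← mk_ktr t' t, ← mk_ktr t t', add_comm t', mk_eq_mk] at hw'
      obtain ⟨s, hs⟩ := hw'
      simp only [ktr_extend, extend_injective.eq_iff, kTrans_kTrans] at hs
      refine ⟨t' + s, kTrans y (t + s) k g, ?_⟩
      rw [← hs, ← kd_kTrans]
      congr 1
      omega
  · rintro ⟨s, hs⟩
    rw [← mk_ktr t s, ktr_extend]
    cases k with
    | zero =>
      rw [show kTrans y s 0 f = 0 from hs, mk_extend_eq_zero.2 ⟨0, by ext; simp [kTrans]⟩]
      exact zero_mem _
    | succ k =>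
      obtain ⟨g, hg⟩ := hs
      exact ⟨mk y N (t + s) (extend g), by rw [cd_mk_extend, hg]⟩

variable {e : Fin n → ℤ} {𝒜 : ℤ → AddSubgroup R} (hy : ∀ j, y j ∈ 𝒜 (e j))
  (ℳ : ℤ → AddSubgroup N) [DirectSum.Decomposition ℳ] [SetLike.GradedSMul 𝒜 ℳ]

lemma kVanish_iff_van (k : ℕ) (ℓ : ℤ) :
    KVanish y ℳ e k ℓ ↔ (GrProj.ofDecomposition hy ℳ).Van k ℓ := by
  constructor
  · intro h z hz hz0
    obtain ⟨t, f, rfl⟩ := exists_mk_extend hz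
    have hp : (GrProj.ofDecomposition hy ℳ).cech.p ℓ (mk y N t (extend f)) =
        mk y N t (extend fun S => (GrProj.ofDecomposition hy ℳ).p (ℓ + t * ∑ j ∈ S.1, e j) (f S)) := by
      rw [GrProj.cech_mk]
      congr 1
      ext S
      by_cases hS : S.card = k
      · rw [extend, extend, dif_pos hS, dif_pos hS]
      · rw [extend_of_ne _ hS, extend_of_ne _ hS, map_zero]
    have h0 := GrProj.cech_cd (GrProj.ofDecomposition hy ℳ) ℓ (mk y N t (extend f))
    rw [hz0, map_zero, hp, cd_mk_extend, eq_comm, mk_extend_eq_zero] at h0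
    obtain ⟨s, hs⟩ := h0
    rw [hp, ← mk_ktr t s, ktr_extend, mk_extend_mem_range_iff]
    refine h _ _ ((kd_kTrans _ _ _).trans hs) fun S => ?_
    rw [kTrans, ← GrProj.p_prod_pow_smul]
    rw [show ℓ + ((t + s : ℕ) : ℤ) * ∑ j ∈ S.1, e j =
      ℓ + t * ∑ j ∈ S.1, e j + s * ∑ j ∈ S.1, e j by push_cast; ring]
    exact GrProj.ofDecomposition_mem hy ℳ _ _
  · intro h t f hf hfℓ
    rw [← mk_extend_mem_range_iff]
    convert h (mk y N t (extend f)) (cdeg_mk_extend t f)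
      (by rw [cd_mk_extend, hf, mk_extend_eq_zero]; exact ⟨0, by ext; simp [kTrans]⟩) using 1
    rw [GrProj.cech_mk]
    congr 1
    ext S
    by_cases hS : S.card = k
    · rw [extend, dif_pos hS, GrProj.ofDecomposition_of_mem hy ℳ (hfℓ ⟨S, hS⟩)]
    · rw [extend_of_ne _ hS, map_zero]

end Comparison

section TorsionGenerators

open Cech

variable {y} {N : Type} [AddCommGroup N] [Module R N]

/-- The component at the empty set of an element of the Čech complex. -/
def Cech.emptyComponent (y : Fin n → R) (N : Type) [AddCommGroup N] [Module R N] :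
    Cech y N →ₗ[R] N :=
  DirectLimit.Module.lift R ℕ (fun _ : ℕ => Finset (Fin n) → N) (fun s t _ => ktr y N (t - s))
    (fun _ => LinearMap.proj ∅) fun s t _ f => by simp [ktr_apply]

lemma Cech.emptyComponent_mk (t : ℕ) (f : Finset (Fin n) → N) :
    emptyComponent y N (mk y N t f) = f ∅ :=
  rfl

/-- The elements annihilated by the `T`-th powers of the `y j`. -/
def powTorsion (y : Fin n → R) (N : Type) [AddCommGroup N] [Module R N] (T : ℕ) :
    Submodule R N :=
  ⨅ j, LinearMap.ker (LinearMap.lsmul R N (y j ^ T))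

lemma mem_powTorsion {T : ℕ} {v : N} : v ∈ powTorsion y N T ↔ ∀ j, y j ^ T • v = 0 := by
  simp [powTorsion, Submodule.mem_iInf]

lemma powTorsion_mono : Monotone (powTorsion y N) := by
  intro s t hst v hv
  rw [mem_powTorsion] at hv ⊢
  intro j
  rw [← Nat.sub_add_cancel hst, pow_add, mul_smul, hv j, smul_zero]

lemma kd_singleton (t : ℕ) (f : KCochain n N 0) (j : Fin n) :
    kd y t 0 f ⟨{j}, rfl⟩ = y j ^ t • f ⟨∅, rfl⟩ := by
  rw [kd, Finset.sum_eq_single ⟨j, Finset.mem_singleton_self j⟩]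
  · simp [Finset.filter_singleton]
  · rintro ⟨k, hk⟩ _ h
    exact absurd (Subtype.ext (Finset.mem_singleton.1 hk)) h
  · exact fun h => absurd (Finset.mem_attach _ _) h

lemma kd_zero_eq_zero {t : ℕ} {f : KCochain n N 0} :
    kd y t 0 f = 0 ↔ f ⟨∅, rfl⟩ ∈ powTorsion y N t := by
  rw [mem_powTorsion]
  constructor
  · intro h j
    rw [← kd_singleton, h, Pi.zero_apply]
  · intro h
    ext ⟨S, hS⟩
    obtain ⟨j, rfl⟩ := Finset.card_eq_one.1 hS
    exact (kd_singleton t f j).trans (h j)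

lemma exists_emptyComponent_mem_powTorsion {z : Cech y N} (hz : cdeg y N 0 z = z)
    (hz0 : cd y N z = 0) : ∃ t, emptyComponent y N z ∈ powTorsion y N t := by
  obtain ⟨t, f, rfl⟩ := exists_mk_extend (k := 0) (by exact_mod_cast hz)
  rw [cd_mk_extend, mk_extend_eq_zero] at hz0
  obtain ⟨s, hs⟩ := hz0
  rw [← kd_kTrans, kd_zero_eq_zero] at hs
  refine ⟨t + s, ?_⟩
  rw [emptyComponent_mk]
  simpa [extend, kTrans] using hs

lemma GrProj.p_mem_powTorsion {e : Fin n → ℤ} (G : GrProj y e N) (ℓ : ℤ) {T : ℕ} {v : N}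
    (hv : v ∈ powTorsion y N T) : G.p ℓ v ∈ powTorsion y N T := by
  rw [mem_powTorsion] at hv ⊢
  intro j
  rw [← G.p_pow_smul, hv j, map_zero]

lemma GrProj.Gen.p_mem_smul_powTorsion {e : Fin n → ℤ} {G : GrProj y e N} {ℓ : ℤ}
    (h : G.Gen 0 ℓ) {T : ℕ} (hT : ∀ m, powTorsion y N m ≤ powTorsion y N T) {v : N}
    (hv : v ∈ powTorsion y N T) :
    G.p ℓ v ∈ Ideal.span (Set.range y) • powTorsion y N T := by
  set f : KCochain n N 0 := fun _ => v
  have hz := cdeg_mk_extend (y := y) T f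
  obtain ⟨ζ, hζ, hζ0⟩ := h (Cech.mk y N T (extend f)) (by exact_mod_cast hz) (by
    rw [cd_mk_extend, kd_zero_eq_zero.2 hv, mk_extend_eq_zero]
    exact ⟨0, by ext; simp [kTrans]⟩)
  obtain ⟨w, hw, hw'⟩ := exists_homog_cd (k := 0) (by
    rw [map_sub, map_sum, ← GrProj.cech_cdeg]
    simp only [map_smul, (hζ _).1]
    congr 2) hζ0
  rw [cdeg_of_neg (by norm_num)] at hw
  rw [← hw, map_zero, eq_comm, sub_eq_zero, GrProj.cech_mk] at hw'
  have := congrArg (emptyComponent y N) hw'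
  rw [emptyComponent_mk, map_sum] at this
  have h1 : G.p ℓ v = ∑ j, y j • emptyComponent y N (ζ j) := by
    simpa [extend, f] using this
  rw [h1]
  refine Submodule.sum_mem _ fun j _ => Submodule.smul_mem_smul (Ideal.subset_span ⟨j, rfl⟩) ?_
  obtain ⟨m, hm⟩ := exists_emptyComponent_mem_powTorsion (hζ j).1 (hζ j).2
  exact hT m hm

/-- Nakayama's lemma for a submodule annihilated by a power of the ideal. -/
lemma le_of_le_sup_smul {I : Ideal R} {W U : Submodule R N} (h : U ≤ W ⊔ I • U) {k : ℕ}
    (hk : I ^ k • U = ⊥) : U ≤ W := by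
  have key : ∀ k, U ≤ W ⊔ I ^ k • U := by
    intro k
    induction k with
    | zero => simp
    | succ k ih =>
      refine h.trans (sup_le le_sup_left ((smul_mono_right I ih).trans ?_))
      rw [Submodule.smul_sup, ← mul_smul, ← pow_succ']
      exact sup_le_sup_right Submodule.smul_le_right _
  simpa [hk] using key k

lemma exists_pow_smul_powTorsion (T : ℕ) :
    ∃ k, Ideal.span (Set.range y) ^ k • powTorsion y N T = ⊥ := by
  obtain ⟨k, hk⟩ := Ideal.exists_pow_le_of_le_radical_of_fg
    (I := Ideal.span (Set.range y)) (J := (powTorsion y N T).annihilator) (by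
      rw [Ideal.span_le]
      rintro _ ⟨j, rfl⟩
      exact ⟨T, Submodule.mem_annihilator.2 fun v hv => mem_powTorsion.1 hv j⟩)
    (Submodule.fg_span (Set.finite_range y))
  refine ⟨k, le_bot_iff.1 ((Submodule.smul_mono_left hk).trans_eq ?_)⟩
  exact Submodule.annihilator_smul _

lemma kGenLE_of_acyc {e : Fin n → ℤ} (ℳ : ℤ → AddSubgroup N) {k : ℕ} {β : ℤ}
    (h : Acyc y N k) : KGenLE y ℳ e k β := by
  intro t ℓ f hf _
  obtain ⟨s, hs⟩ := (mk_extend_mem_range_iff t f).1 (h _ (cdeg_mk_extend t f) (by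
    rw [cd_mk_extend, hf, mk_extend_eq_zero]
    exact ⟨0, by ext; simp [kTrans]⟩))
  exact ⟨s, kTrans y s k f, 0, hs, zero_mem _, (add_zero _).symm⟩

variable {e : Fin n → ℤ} {𝒜 : ℤ → AddSubgroup R} (hy : ∀ j, y j ∈ 𝒜 (e j))
  (ℳ : ℤ → AddSubgroup N) [DirectSum.Decomposition ℳ] [SetLike.GradedSMul 𝒜 ℳ]

lemma powTorsion_le_span {β : ℤ}
    (h : ∀ ℓ, β < ℓ → (GrProj.ofDecomposition hy ℳ).Gen 0 ℓ) {T : ℕ}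
    (hT : ∀ m, powTorsion y N m ≤ powTorsion y N T) :
    powTorsion y N T ≤ Submodule.span R {v | v ∈ powTorsion y N T ∧ ∃ ℓ ≤ β, v ∈ ℳ ℓ} := by
  obtain ⟨k, hk⟩ := exists_pow_smul_powTorsion (y := y) (N := N) T
  refine le_of_le_sup_smul (fun v hv => ?_) hk
  classical
  rw [← DirectSum.sum_support_decompose ℳ v]
  refine Submodule.sum_mem _ fun ℓ _ => ?_
  have hvℓ := (GrProj.ofDecomposition hy ℳ).p_mem_powTorsion ℓ hv
  rcases le_or_gt ℓ β with hℓ | hℓ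
  · exact Submodule.mem_sup_left
      (Submodule.subset_span ⟨hvℓ, ℓ, hℓ, GrProj.ofDecomposition_mem hy ℳ ℓ v⟩)
  · exact Submodule.mem_sup_right ((h ℓ hℓ).p_mem_smul_powTorsion hT hv)

lemma kGenLE_zero_of_gen [IsNoetherian R N] {β : ℤ}
    (h : ∀ ℓ, β < ℓ → (GrProj.ofDecomposition hy ℳ).Gen 0 ℓ) : KGenLE y ℳ e 0 β := by
  obtain ⟨T, hT⟩ := monotone_stabilizes_iff_noetherian.2 ‹IsNoetherian R N›
    ⟨powTorsion y N, powTorsion_mono⟩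
  intro t ℓ f hf _
  have hs : ∀ m, powTorsion y N m ≤ powTorsion y N (t + T) := fun m =>
    (powTorsion_mono (le_max_left m T)).trans
      (((hT _ (le_max_right m T)).symm.trans (hT _ (Nat.le_add_left T t))).le)
  refine ⟨T, 0, kTrans y T 0 f, rfl, ?_, (zero_add _).symm⟩
  let c : N →ₗ[R] KCochain n N 0 := LinearMap.pi fun _ => LinearMap.id
  have hc : kTrans y T 0 f = c (f ⟨∅, rfl⟩) := by
    ext ⟨S, hS⟩
    obtain rfl := Finset.card_eq_zero.1 hS
    simp [kTrans, c]
  have hmem := powTorsion_le_span hy ℳ h hs (hs t (kd_zero_eq_zero.1 hf))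
  rw [hc]
  refine Submodule.span_mono ?_ (Submodule.span_image c ▸ Submodule.mem_map_of_mem hmem)
  rintro _ ⟨v, ⟨hv, ℓ', hℓ', hvℓ⟩, rfl⟩
  refine ⟨kd_zero_eq_zero.2 hv, ℓ', hℓ', ?_⟩
  rintro ⟨S, hS⟩
  obtain rfl := Finset.card_eq_zero.1 hS
  simpa [c] using hvℓ

end TorsionGenerators

section Generators

variable {N : Type} [AddCommGroup N] [Module R N] {ℳ : ℤ → AddSubgroup N}

lemma GenDegLE.exists_generators [Module.Finite R N] {β : ℤ} (h : GenDegLE (R := R) ℳ β) :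
    ∃ (r : ℕ) (c : Fin r → N) (b : Fin r → ℤ), Submodule.span R (Set.range c) = ⊤ ∧
      ∀ i, b i ≤ β ∧ c i ∈ ℳ (b i) := by
  rw [GenDegLE] at h
  obtain ⟨s, hs, hs'⟩ := (Submodule.fg_span_iff_fg_span_finset_subset _).1
    (h ▸ Module.Finite.fg_top (R := R) (M := N))
  have hb : ∀ x : s, ∃ b ≤ β, (x : N) ∈ ℳ b := fun x => by simpa using hs x.2
  choose b hb hb' using hb
  refine ⟨s.card, fun i => s.equivFin.symm i, fun i => b (s.equivFin.symm i), ?_,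
    fun i => ⟨hb _, hb' _⟩⟩
  rw [← h, hs']
  congr 1
  exact (s.equivFin.symm.surjective.range_comp Subtype.val).trans Subtype.range_coe

lemma GenDegLE.van [IsNoetherianRing R] [Module.Finite R N] {y : Fin n → R} {e : Fin n → ℤ}
    {𝒜 : ℤ → AddSubgroup R} [GradedRing 𝒜] (hy : ∀ j, y j ∈ 𝒜 (e j))
    [DirectSum.Decomposition ℳ] [SetLike.GradedSMul 𝒜 ℳ] {d : ℕ}
    (hdim : ringKrullDim R = (d : WithBot (WithTop ℕ))) {β γ : ℤ} (h : GenDegLE (R := R) ℳ β)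
    (hR : ∀ ℓ, γ < ℓ → (GrProj.ofDecomposition hy 𝒜).Van d ℓ) {ℓ : ℤ} (hℓ : β + γ < ℓ) :
    (GrProj.ofDecomposition hy ℳ).Van d ℓ := by
  obtain ⟨r, c, b, hc, hb⟩ := h.exists_generators
  refine GrProj.Van.of_generators c b hc (fun i ℓ a => ?_)
    (fun i => hR _ (by have := (hb i).1; omega)) (Acyc.of_ringKrullDim hdim (by omega))
  exact (GrProj.map_ofDecomposition hy 𝒜 ℳ (LinearMap.toSpanSingleton R N (c i)) (b i)
    (fun ℓ a ha => SetLike.GradedSMul.smul_mem ha (hb i).2) ℓ a).symm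

end Generators

lemma sum_le_sum_filter_lt {e : Fin n → ℤ} (he : Antitone e) (S : Finset (Fin n)) :
    ∑ j ∈ S, e j ≤ ∑ j ∈ Finset.univ.filter (fun j : Fin n => (j : ℕ) < S.card), e j := by
  have hS : S.card ≤ n := by simpa using S.card_le_univ
  have h1 : ∑ j ∈ S, e j = ∑ i : Fin S.card, e (S.orderEmbOfFin rfl i) := by
    conv_lhs => rw [← Finset.map_orderEmbOfFin_univ S rfl, Finset.sum_map]
    rfl
  have h2 : ∑ j ∈ Finset.univ.filter (fun j : Fin n => (j : ℕ) < S.card), e j =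
      ∑ i : Fin S.card, e (Fin.castLE hS i) := by
    symm
    refine Finset.sum_bij (fun i _ => Fin.castLE hS i) ?_ ?_ ?_ ?_
    · simp
    · exact fun _ _ _ _ h => Fin.castLE_injective hS h
    · exact fun j hj => ⟨⟨j, (Finset.mem_filter.1 hj).2⟩, Finset.mem_univ _, rfl⟩
    · simp
  rw [h1, h2]
  refine Finset.sum_le_sum fun i _ => he ?_
  have key : ∀ (m : ℕ) (hm : m < S.card), m ≤ (S.orderEmbOfFin rfl ⟨m, hm⟩ : ℕ) := by
    intro m
    induction m with
    | zero => exact fun _ => Nat.zero_le _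
    | succ m ih =>
      intro hm
      refine (ih (by omega)).trans_lt ?_
      exact (S.orderEmbOfFin rfl).strictMono (Nat.lt_succ_self m)
  exact key i i.2

theorem statement6
    (𝒜 : ℤ → AddSubgroup R) [GradedRing 𝒜]
    (hNoeth : IsNoetherianRing R)
    (hnonneg : ∀ i : ℤ, i < 0 → 𝒜 i = ⊥)
    -- `R₀` is an Artinian local ring
    (hloc : IsLocalRing ↥(𝒜 0)) (hart : IsArtinianRing ↥(𝒜 0))
    -- `R` is Cohen–Macaulay with `dim R = d`
    (d : ℕ) (hdim : ringKrullDim R = (d : WithBot (WithTop ℕ)))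
    (hCM : depthGE (maxHomIdeal 𝒜) R d)
    -- `y` is a minimal homogeneous generating set of `𝔪` with degrees
    -- `e 0 ≥ e 1 ≥ ⋯` (used both for `Θ_t` and to compute local cohomology)
    (n : ℕ) (y : Fin n → R) (e : Fin n → ℤ)
    (hyhomog : ∀ j, y j ∈ 𝒜 (e j))
    (hygen : Ideal.span (Set.range y) = maxHomIdeal 𝒜)
    (hymin : ∀ j, y j ∉ Ideal.span (y '' {k | k ≠ j}))
    (hsorted : ∀ j k : Fin n, j ≤ k → e k ≤ e j)
    -- `C_•` a graded complex of finitely generated graded modules, `M = H₀(C_•)`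
    (M : Type) [AddCommGroup M] [Module R M]
    (ℳ : ℤ → AddSubgroup M) [DirectSum.Decomposition ℳ] [SetLike.GradedSMul 𝒜 ℳ]
    (C : ℕ → Type) [∀ j, AddCommGroup (C j)] [∀ j, Module R (C j)]
    (hCfin : ∀ j, Module.Finite R (C j))
    (dl : ∀ j, C (j + 1) →ₗ[R] C j)
    (hcomplex : ∀ j, (dl j).comp (dl (j + 1)) = 0)
    (𝒞 : ∀ j, ℤ → AddSubgroup (C j))
    [∀ j, DirectSum.Decomposition (𝒞 j)] [∀ j, SetLike.GradedSMul 𝒜 (𝒞 j)]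
    (hdlhomog : ∀ (j : ℕ) (ℓ : ℤ), ∀ x ∈ 𝒞 (j + 1) ℓ, dl j x ∈ 𝒞 j ℓ)
    (π : C 0 →ₗ[R] M) (hπsurj : Function.Surjective π)
    (hπker : LinearMap.ker π = LinearMap.range (dl 0))
    (hπhomog : ∀ (ℓ : ℤ), ∀ x ∈ 𝒞 0 ℓ, π x ∈ ℳ ℓ)
    -- `1 ≤ t ≤ i ≤ d`
    (i t : ℕ) (ht1 : 1 ≤ t) (hti : t ≤ i) (hid : i ≤ d)
    -- `H^{i-t}_𝔪(M)` is finitely generated as an `R`-module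
    (hfg : Module.Finite R
      ↥((localCohomology (maxHomIdeal 𝒜) (i - t)).obj (ModuleCat.of R M)))
    -- (1) `i ≤ depth M/H⁰_𝔪(M)`
    (h1 : depthGE (maxHomIdeal 𝒜) (M ⧸ torsionSubmodule (maxHomIdeal 𝒜) M) i)
    -- (2) `dim H_j(C_•) ≤ i + j - t` for `1 ≤ j ≤ d - 1 - i + t`
    (h2 : ∀ jm1 : ℕ, ((jm1 + 1 : ℕ) : ℤ) ≤ (d : ℤ) - 1 - i + t →
      modDimLE (R := R) (Hmod C dl jm1) (i + (jm1 + 1) - t))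
    -- (3) `C_j` is maximal Cohen–Macaulay for `0 ≤ j ≤ d - i + t`
    (h3 : ∀ j : ℕ, j ≤ d - i + t → depthGE (maxHomIdeal 𝒜) (C j) d) :
    -- conclusion: `max{ b₀(H^{i-t}_𝔪(M)) − Θ_t, a_i(M) } ≤ b₀(C_{d-i}) + a(R)`
    ∀ β γ : ℤ,
      GenDegLE (R := R) (𝒞 (d - i)) β →
      (∀ ℓ : ℤ, γ < ℓ → KVanish y (fun j => 𝒜 j) e d ℓ) →
      (KGenLE y ℳ e (i - t)
        (β + γ + (∑ j ∈ Finset.univ.filter (fun j : Fin n => (j : ℕ) < t), e j))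
      ∧ ∀ ℓ : ℤ, β + γ < ℓ → KVanish y ℳ e i ℓ) := by
  intro β γ hβ hγ
  let G : ∀ j, GrProj y e (C j) := fun j => GrProj.ofDecomposition hyhomog (𝒞 j)
  have hdec : ∀ j ℓ x, dl j ((G (j + 1)).p ℓ x) = (G j).p ℓ (dl j x) := fun j ℓ x => by
    simpa using GrProj.map_ofDecomposition hyhomog _ (𝒞 j) (dl j) 0
      (fun ℓ x hx => by simpa using hdlhomog j ℓ x hx) ℓ x
  have hδ : ∀ j x, dl j (dl (j + 1) x) = 0 := fun j => LinearMap.congr_fun (hcomplex j)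
  have hC : ∀ (j : ℕ) (k : ℤ), j + i ≤ d + t → k < d → Acyc y (C j) k := fun j k hj hk =>
    Acyc.of_depthGE hygen (h3 j (by omega)) hk
  have hH : ∀ (j : ℕ) (k : ℤ), j + i + 2 ≤ d + t → (i + j + 2 : ℤ) ≤ k + t →
      Acyc y (Hmod C dl j) k := fun j k hj hk =>
    Acyc.of_modDimLE (h2 j (by omega)) (by omega)
  have hvan : ∀ ℓ, β + γ < ℓ → (G (d - i)).Van d ℓ :=
    fun ℓ hℓ => hβ.van hyhomog hdim (fun ℓ' hℓ' => (kVanish_iff_van hyhomog 𝒜 d ℓ').1 (hγ ℓ' hℓ')) hℓ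
  let φ : Cok C dl 0 ≃ₗ[R] M :=
    (Submodule.quotEquivOfEq _ _ hπker.symm).trans (π.quotKerEquivOfSurjective hπsurj)
  have hφ : ∀ ℓ x, φ ((gradCok C dl G hdec 0).p ℓ x) =
      (GrProj.ofDecomposition hyhomog ℳ).p ℓ (φ x) := by
    intro ℓ x
    obtain ⟨x, rfl⟩ := Submodule.mkQ_surjective _ x
    rw [← gradCok_mkQ]
    have := GrProj.map_ofDecomposition hyhomog (𝒞 0) ℳ π 0
      (fun ℓ x hx => by simpa using hπhomog ℓ x hx) ℓ x
    rwa [add_zero] at this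
  have : Module.Finite R M := Module.Finite.of_surjective π hπsurj
  have hacyc : ∀ k : ℤ, 0 < k → k < i → Acyc y M k := fun k =>
    Acyc.of_quotient_torsionSubmodule hygen h1
  constructor
  · rcases hti.lt_or_eq with hlt | rfl
    · exact kGenLE_of_acyc ℳ (hacyc _ (by omega) (by omega))
    · rw [Nat.sub_self]
      refine kGenLE_zero_of_gen hyhomog ℳ fun ℓ hℓ => GrProj.Gen.of_equiv φ hφ ?_
      refine Gen.cok_zero_of_van C dl G hdec hδ hC hH rfl ht1 hid hdim
        (fun j hj s => KExact.of_depthGE hdim hygen (h3 j (by omega)))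
        (fun k hk hkt => Acyc.of_equiv φ.symm (hacyc k hk hkt)) (b := β + γ) ?_ fun S hS => ?_
      · intro j hj
        obtain rfl : j = d - t := by omega
        exact hvan
      · have := sum_le_sum_filter_lt (fun j k h => hsorted j k h) S
        rw [hS] at this
        omega
  · intro ℓ hℓ
    rw [kVanish_iff_van hyhomog]
    refine GrProj.Van.of_equiv φ hφ ?_
    refine Van.cok_zero C dl G hdec hδ hC hH ht1 (d - i) (by omega) ?_
    rw [show ((d - i : ℕ) : ℤ) + i = d by omega]
    exact GrProj.Van.of_middle (Submodule.injective_subtype _) (Submodule.mkQ_surjective _)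
      (LinearMap.exact_subtype_mkQ _) (fun ℓ x => (gradCok_mkQ C dl G hdec _ ℓ x).symm)
      (Acyc.of_ringKrullDim hdim (by omega)) (hvan ℓ hℓ)

end Paper
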